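/- arXiv:1301.4065 — 2 statements merged into one kernel-verified Lean document; each statement's English description precedes it below -/
import Mathlib

section
/- Let Σ ⊂ ℝ^{n+1} be a translating soliton with tangential translation field V and Gauss map u. Then the Bochner-type formula Δ|∇u|² = 2|∇du|² - 2|∇u|⁴ - ⟨V, ∇|∇u|²⟩ holds on Σ. -/
open scoped BigOperators RealInnerProductSpace
open Real

noncomputable section

/-- Partial derivative (in the `i`-th chart direction) of a vector-valued map on ℝⁿ. -/
def pdv {n m : ℕ} (i : Fin n) (f : (Fin n → ℝ) → EuclideanSpace ℝ (Fin m))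
    (x : Fin n → ℝ) : EuclideanSpace ℝ (Fin m) :=
  fderiv ℝ f x (Pi.single i 1)

/-- Partial derivative of a scalar function on ℝⁿ. -/
def pdr {n : ℕ} (i : Fin n) (f : (Fin n → ℝ) → ℝ) (x : Fin n → ℝ) : ℝ :=
  fderiv ℝ f x (Pi.single i 1)

/-- Induced metric g_{ij} = ⟪∂_i F, ∂_j F⟫ of an immersion F. -/
def gmet {n : ℕ} (F : (Fin n → ℝ) → EuclideanSpace ℝ (Fin (n + 1)))
    (x : Fin n → ℝ) : Matrix (Fin n) (Fin n) ℝ :=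
  Matrix.of fun i j => ⟪pdv i F x, pdv j F x⟫

/-- Second fundamental form h_{ij} w.r.t. the outer unit normal ν
(convention: positive for convex hypersurfaces with outer normal). -/
def sff {n : ℕ} (F : (Fin n → ℝ) → EuclideanSpace ℝ (Fin (n + 1)))
    (ν : (Fin n → ℝ) → EuclideanSpace ℝ (Fin (n + 1)))
    (x : Fin n → ℝ) (i j : Fin n) : ℝ :=
  -⟪pdv i (fun y => pdv j F y) x, ν x⟫

/-- Mean curvature H = g^{ij} h_{ij}. -/
def meanCurv {n : ℕ} (F ν : (Fin n → ℝ) → EuclideanSpace ℝ (Fin (n + 1)))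
    (x : Fin n → ℝ) : ℝ :=
  ∑ i, ∑ j, (gmet F x)⁻¹ i j * sff F ν x i j

/-- Christoffel symbols Γ^k_{ij} of the induced metric. -/
def chr {n : ℕ} (F : (Fin n → ℝ) → EuclideanSpace ℝ (Fin (n + 1)))
    (x : Fin n → ℝ) (k i j : Fin n) : ℝ :=
  ∑ l, (gmet F x)⁻¹ k l * ⟪pdv i (fun y => pdv j F y) x, pdv l F x⟫

/-- Scalar Laplace–Beltrami operator of the induced metric. -/
def lapS {n : ℕ} (F : (Fin n → ℝ) → EuclideanSpace ℝ (Fin (n + 1)))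
    (f : (Fin n → ℝ) → ℝ) (x : Fin n → ℝ) : ℝ :=
  ∑ i, ∑ j, (gmet F x)⁻¹ i j *
    (pdr i (fun y => pdr j f y) x - ∑ k, chr F x k i j * pdr k f x)

/-- Componentwise Laplace–Beltrami operator on ℝ^{n+1}-valued maps. -/
def lapV {n : ℕ} (F : (Fin n → ℝ) → EuclideanSpace ℝ (Fin (n + 1)))
    (f : (Fin n → ℝ) → EuclideanSpace ℝ (Fin (n + 1)))
    (x : Fin n → ℝ) : EuclideanSpace ℝ (Fin (n + 1)) :=
  ∑ i, ∑ j, (gmet F x)⁻¹ i j •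
    (pdv i (fun y => pdv j f y) x - ∑ k, chr F x k i j • pdv k f x)

/-- Energy density |∇u|² = g^{ij}⟪∂_i u, ∂_j u⟫ of the Gauss map u = ν. -/
def eDen {n : ℕ} (F ν : (Fin n → ℝ) → EuclideanSpace ℝ (Fin (n + 1)))
    (x : Fin n → ℝ) : ℝ :=
  ∑ i, ∑ j, (gmet F x)⁻¹ i j * ⟪pdv i ν x, pdv j ν x⟫


/-- Second fundamental form ∇du of the sphere-valued Gauss map u = ν:
the projection, orthogonal to u, of the covariant Hessian of u. -/
def mapHess {n : ℕ} (F ν : (Fin n → ℝ) → EuclideanSpace ℝ (Fin (n + 1)))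
    (x : Fin n → ℝ) (i j : Fin n) : EuclideanSpace ℝ (Fin (n + 1)) :=
  (pdv i (fun y => pdv j ν y) x - ∑ k, chr F x k i j • pdv k ν x)
    - ⟪pdv i (fun y => pdv j ν y) x - ∑ k, chr F x k i j • pdv k ν x, ν x⟫ • ν x

/-- Squared norm |∇du|² of the second fundamental form of the Gauss map. -/
def mapHessNormSq {n : ℕ} (F ν : (Fin n → ℝ) → EuclideanSpace ℝ (Fin (n + 1)))
    (x : Fin n → ℝ) : ℝ :=
  ∑ i, ∑ j, ∑ k, ∑ l, (gmet F x)⁻¹ i k * (gmet F x)⁻¹ j l *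
    ⟪mapHess F ν x i j, mapHess F ν x k l⟫

section TangentialDerivations

variable {R ι : Type*} [CommRing R] [Algebra ℝ R] [Fintype ι]

theorem sum_mul_derivation_eq_zero_of_unit {ν : ι → R} (hunit : ∑ a, ν a * ν a = 1)
    (d : Derivation ℝ R R) : ∑ a, ν a * d (ν a) = 0 := by
  have h : (2 : ℝ) • ∑ a, ν a * d (ν a) = 0 := by
    have h1 := congrArg d hunit
    simp only [map_sum, Derivation.leibniz, smul_eq_mul, Derivation.map_one_eq_zero] at h1
    rw [two_smul, ← Finset.sum_add_distrib]
    exact h1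
  simpa using congrArg (fun y => (2⁻¹ : ℝ) • y) h

variable {δ : ι → Derivation ℝ R R} {ν T : ι → R}

theorem sum_mul_derivation_shape (hunit : ∑ a, ν a * ν a = 1) (a b : ι) :
    ∑ d, ν d * δ a (δ b (ν d)) = -∑ d, δ a (ν d) * δ b (ν d) := by
  have h := congrArg (δ a) (sum_mul_derivation_eq_zero_of_unit hunit (δ b))
  simp only [map_sum, Derivation.leibniz, smul_eq_mul, map_zero, Finset.sum_add_distrib] at h
  rw [eq_neg_iff_add_eq_zero, ← h]
  simp only [mul_comm]

theorem tangential_bochner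
    (hνδ : ∀ f, ∑ a, ν a * δ a f = 0)
    (hunit : ∑ a, ν a * ν a = 1)
    (hsym : ∀ a b, δ a (ν b) = δ b (ν a))
    (hcomm : ∀ a b f, δ a (δ b f) = δ b (δ a f)
      + ν a * ∑ c, δ c (ν b) * δ c f - ν b * ∑ c, δ c (ν a) * δ c f)
    (hconst : ∀ a b, δ a (T b) = 0)
    (hT : ∑ a, T a * ν a = -∑ a, δ a (ν a)) :
    ∑ c, δ c (δ c (∑ a, ∑ b, δ a (ν b) * δ a (ν b)))
      = 2 * (∑ a, ∑ b, ∑ c, δ a (δ b (ν c)) * δ a (δ b (ν c))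
          - 2 * ∑ a, ∑ b, (∑ c, δ c (ν a) * δ c (ν b)) * ∑ c, δ c (ν a) * δ c (ν b))
        - 2 * (∑ a, ∑ b, δ a (ν b) * δ a (ν b)) ^ 2
        - ∑ c, T c * δ c (∑ a, ∑ b, δ a (ν b) * δ a (ν b)) := by
  obtain ⟨S, hS⟩ : ∃ S : ι → ι → R, ∀ a b, δ a (ν b) = S a b := ⟨_, fun _ _ => rfl⟩
  obtain ⟨Q, hQ⟩ : ∃ Q : ι → ι → R, ∀ a b, ∑ c, S c a * S c b = Q a b := ⟨_, fun _ _ => rfl⟩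
  obtain ⟨N, hN⟩ : ∃ N : R, ∑ a, ∑ b, S a b * S a b = N := ⟨_, rfl⟩
  obtain ⟨H, hH⟩ : ∃ H : R, ∑ a, S a a = H := ⟨_, rfl⟩
  have hSs : ∀ a b, S a b = S b a := fun a b => by rw [← hS, ← hS, hsym]
  have hSν : ∀ a, ∑ b, ν b * S a b = 0 := fun a => by
    simpa only [hS] using sum_mul_derivation_eq_zero_of_unit hunit (δ a)
  have hνS : ∀ b, ∑ a, ν a * S a b = 0 := fun b => by simpa only [hS] using hνδ (ν b)
  have hYν : ∀ a b, ∑ d, ν d * δ a (S b d) = -Q a b := fun a b => by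
    have := sum_mul_derivation_shape (δ := δ) hunit a b
    simp only [hS] at this
    rw [this, ← hQ]
    congr 1
    exact Finset.sum_congr rfl fun d _ => by rw [hSs a d, hSs b d]
  have hcod : ∀ c a b, δ c (S a b) = δ a (S c b) + ν c * Q a b - ν a * Q c b :=
    fun c a b => by
    have := hcomm c a (ν b)
    simpa only [hS, hQ] using this
  have hνQ : ∀ b, ∑ c, ν c * Q b c = 0 := fun b => by
    simp only [← hQ, Finset.mul_sum]
    rw [Finset.sum_comm]
    refine Finset.sum_eq_zero fun d _ => ?_
    calc ∑ c, ν c * (S d b * S d c) = S d b * ∑ c, ν c * S d c := by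
          rw [Finset.mul_sum]; exact Finset.sum_congr rfl fun _ _ => by ring
      _ = 0 := by rw [hSν, mul_zero]
  have htrQ : ∑ c, Q c c = N := by
    simp only [← hQ, ← hN]; exact Finset.sum_comm
  have hdH : ∀ b, δ b H = -∑ c, T c * S b c := fun b => by
    have h := congrArg (δ b) hT
    simp only [hS, hH, map_sum, map_neg, Derivation.leibniz, smul_eq_mul, hconst, mul_zero,
      add_zero] at h
    rw [h, neg_neg]
  have hdiv : ∀ b, ∑ c, δ c (S c b) = -∑ c, T c * S b c - ν b * N := fun b => by
    calc ∑ c, δ c (S c b) = ∑ c, (δ b (S c c) + ν c * Q b c - ν b * Q c c) :=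
          Finset.sum_congr rfl fun c _ => by rw [hSs c b, hcod]
      _ = _ := by
        rw [Finset.sum_sub_distrib, Finset.sum_add_distrib, hνQ, ← map_sum, hH, hdH,
          ← Finset.mul_sum, htrQ, add_zero]
  obtain ⟨t3, ht3⟩ : ∃ t : R, ∑ a, ∑ b, S a b * Q a b = t := ⟨_, rfl⟩
  obtain ⟨t4, ht4⟩ : ∃ t : R, ∑ a, ∑ b, Q a b * Q a b = t := ⟨_, rfl⟩
  have hcontrν : ∀ x : ι → R, ∑ a, ∑ b, S a b * (ν a * x b) = 0 := fun x => by
    rw [Finset.sum_comm]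
    refine Finset.sum_eq_zero fun b _ => ?_
    calc ∑ a, S a b * (ν a * x b) = (∑ a, ν a * S a b) * x b := by
          rw [Finset.sum_mul]; exact Finset.sum_congr rfl fun _ _ => by ring
      _ = 0 := by rw [hνS, zero_mul]
  have hcontrν' : ∀ x : ι → R, ∑ a, ∑ b, S a b * (ν b * x a) = 0 := fun x => by
    refine Finset.sum_eq_zero fun a _ => ?_
    calc ∑ b, S a b * (ν b * x a) = (∑ b, ν b * S a b) * x a := by
          rw [Finset.sum_mul]; exact Finset.sum_congr rfl fun _ _ => by ring
      _ = 0 := by rw [hSν, zero_mul]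
  have hS3 : ∑ a, ∑ b, S a b * ∑ d, S d a * Q d b = t4 := by
    have e : ∀ b, ∑ a, S a b * ∑ d, S d a * Q d b = ∑ d, Q d b * Q d b := fun b => by
      simp only [Finset.mul_sum]
      rw [Finset.sum_comm]
      refine Finset.sum_congr rfl fun d _ => ?_
      rw [← hQ d b, Finset.sum_mul]
      exact Finset.sum_congr rfl fun a _ => by rw [hSs d a]; ring
    rw [← ht4, Finset.sum_comm, Finset.sum_comm (f := fun a b => Q a b * Q a b)]
    exact Finset.sum_congr rfl fun b _ => e b
  have hHQ : ∑ a, ∑ b, S a b * (H * Q a b) = H * t3 := by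
    simp only [mul_left_comm _ H, ← Finset.mul_sum, ht3]
  have hTS : ∑ a, ∑ b, S a b * ∑ c, T c * δ a (S b c)
      = ∑ a, ∑ b, S a b * (∑ c, T c * δ c (S a b)) + H * t3 := by
    have hTν : ∑ c, T c * ν c = -H := by rw [hT]; simp only [hS, hH]
    have key : ∀ a b, ∑ c, T c * δ a (S b c) = ∑ c, T c * δ c (S a b)
        + ν a * (∑ c, T c * Q c b) + H * Q a b := fun a b => by
      calc ∑ c, T c * δ a (S b c)
          = ∑ c, (T c * δ c (S a b) + ν a * (T c * Q c b) - (T c * ν c) * Q a b) :=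
            Finset.sum_congr rfl fun c _ => by rw [hSs b c, hcod a c b]; ring
        _ = _ := by
          rw [Finset.sum_sub_distrib, Finset.sum_add_distrib, ← Finset.mul_sum,
            ← Finset.sum_mul, hTν]
          ring
    simp only [key, mul_add, Finset.sum_add_distrib, hcontrν, add_zero, hHQ]
  have hlap : ∀ a b, ∑ c, δ c (δ c (S a b))
      = (-∑ c, T c * δ a (S b c)) - S a b * N - ν b * δ a N
        - ∑ d, S d a * Q d b - ν a * (∑ c, ∑ d, S d c * δ d (S c b))
        + H * Q a b - ∑ d, S d a * Q d b - ν a * ∑ c, δ c (Q c b) := fun a b => by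
    have h1 : ∑ c, δ c (δ a (S c b)) = (-∑ c, T c * δ a (S b c)) - S a b * N - ν b * δ a N
        - ∑ d, S d a * Q d b - ν a * (∑ c, ∑ d, S d c * δ d (S c b)) := by
      calc ∑ c, δ c (δ a (S c b))
          = ∑ c, (δ a (δ c (S c b)) + ∑ d, S d a * (ν c * δ d (S b c))
              - ν a * ∑ d, S d c * δ d (S c b)) :=
            Finset.sum_congr rfl fun c _ => by
              rw [hcomm c a, Finset.mul_sum]
              simp only [hS]
              congr 2
              exact Finset.sum_congr rfl fun d _ => by rw [hSs c b]; ring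
        _ = _ := by
          rw [Finset.sum_sub_distrib, Finset.sum_add_distrib, ← map_sum, hdiv, Finset.sum_comm]
          simp only [← Finset.mul_sum, hYν]
          simp only [map_sub, map_neg, map_sum, Derivation.leibniz, smul_eq_mul, hconst, hS,
            mul_zero, add_zero, mul_neg, Finset.sum_neg_distrib]
          ring
    have h2 : ∑ c, δ c (ν c * Q a b) = H * Q a b := by
      simp only [Derivation.leibniz, smul_eq_mul, Finset.sum_add_distrib, hνδ, hS,
        ← Finset.mul_sum, hH, zero_add]
      rw [mul_comm]
    have h3 : ∑ c, δ c (ν a * Q c b) = ∑ d, S d a * Q d b + ν a * ∑ c, δ c (Q c b) := by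
      simp only [Derivation.leibniz, smul_eq_mul, Finset.sum_add_distrib, hS, Finset.mul_sum]
      rw [add_comm]
      simp only [mul_comm]
    have h4 : ∑ c, δ c (δ c (S a b))
        = ∑ c, δ c (δ a (S c b)) + ∑ c, δ c (ν c * Q a b) - ∑ c, δ c (ν a * Q c b) := by
      rw [← Finset.sum_add_distrib, ← Finset.sum_sub_distrib]
      refine Finset.sum_congr rfl fun c _ => ?_
      rw [hcod c a b, map_sub, map_add]
    rw [h4, h1, h2, h3]
    ring
  have hSlap : ∑ a, ∑ b, S a b * ∑ c, δ c (δ c (S a b))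
      = -(∑ a, ∑ b, S a b * ∑ c, T c * δ c (S a b)) - 2 * t4 - N ^ 2 := by
    have e1 : ∑ a, ∑ b, S a b * (S a b * N) = N ^ 2 := by
      simp only [← mul_assoc, ← Finset.sum_mul, hN, sq]
    simp only [hlap, mul_add, mul_sub, mul_neg, Finset.sum_add_distrib, Finset.sum_sub_distrib,
      Finset.sum_neg_distrib, hcontrν, hcontrν', hS3, hTS, e1, hHQ]
    ring
  have hdN : ∀ c, δ c N = 2 * ∑ a, ∑ b, S a b * δ c (S a b) := fun c => by
    simp only [← hN, map_sum, Derivation.leibniz, smul_eq_mul, Finset.mul_sum]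
    exact Finset.sum_congr rfl fun a _ => Finset.sum_congr rfl fun b _ => by ring
  have hTN : ∑ c, T c * δ c N = 2 * ∑ a, ∑ b, S a b * ∑ c, T c * δ c (S a b) := by
    simp only [hdN, Finset.mul_sum]
    rw [Finset.sum_comm]
    refine Finset.sum_congr rfl fun a _ => ?_
    rw [Finset.sum_comm]
    exact Finset.sum_congr rfl fun b _ => Finset.sum_congr rfl fun c _ => by ring
  have hlapN : ∑ c, δ c (δ c N) = 2 * ∑ a, ∑ b, ∑ c, δ a (S b c) * δ a (S b c)
      + 2 * ∑ a, ∑ b, S a b * ∑ c, δ c (δ c (S a b)) := by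
    have e : ∀ c, δ c (δ c N) = 2 * (∑ a, ∑ b, δ c (S a b) * δ c (S a b))
        + 2 * ∑ a, ∑ b, S a b * δ c (δ c (S a b)) := fun c => by
      rw [hdN, two_mul, map_add, ← two_mul]
      simp only [map_sum, Derivation.leibniz, smul_eq_mul, Finset.sum_add_distrib]
      ring
    simp only [e, Finset.sum_add_distrib, ← Finset.mul_sum]
    congr 2
    rw [Finset.sum_comm]
    refine Finset.sum_congr rfl fun a _ => ?_
    rw [Finset.sum_comm]
    simp only [Finset.mul_sum]
  simp only [hS, hQ, hN]
  rw [hlapN, hSlap, hTN, ht4]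
  ring

end TangentialDerivations

section Frame

variable {R ι κ : Type*} [CommRing R] [Fintype ι] [Fintype κ]

theorem transpose_mul_mul_eq_one_sub_vecMulVec [DecidableEq ι] [DecidableEq κ]
    (hcard : Fintype.card ι = Fintype.card κ + 1) {E : Matrix κ ι R} {G : Matrix κ κ R}
    {ν : ι → R} (hG : E * E.transpose * G = 1) (hunit : ν ⬝ᵥ ν = 1) (horth : E.mulVec ν = 0) :
    E.transpose * G * E = 1 - Matrix.vecMulVec ν ν := by
  have hAB : Matrix.fromRows E (Matrix.replicateRow Unit ν)
      * Matrix.fromCols (E.transpose * G) (Matrix.replicateCol Unit ν) = 1 := by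
    rw [Matrix.fromRows_mul_fromCols, ← Matrix.fromBlocks_one, ← Matrix.mul_assoc, hG]
    congr 1
    · ext i j
      exact congrFun horth i
    · rw [← Matrix.mul_assoc]
      convert Matrix.zero_mul G
      ext i j
      simpa [Matrix.mul_apply, Matrix.mulVec, dotProduct, mul_comm] using congrFun horth j
    · ext i j
      simpa [Matrix.mul_apply, dotProduct] using hunit
  have e : κ ⊕ Unit ≃ ι := Fintype.equivOfCardEq (by simp [hcard])
  have hBA := (Matrix.mul_eq_one_comm_of_equiv e).1 hAB
  rw [Matrix.fromCols_mul_fromRows] at hBA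
  rw [eq_sub_iff_add_eq, ← hBA]
  congr 1
  ext i j
  simp [Matrix.mul_apply, Matrix.vecMulVec_apply]

theorem sum_metric_mul_eq [DecidableEq ι] {E : Matrix κ ι R} {G : Matrix κ κ R} {ν : ι → R}
    (hP : E.transpose * G * E = 1 - Matrix.vecMulVec ν ν) (x y : ι → R) :
    ∑ i, ∑ j, G i j * ((∑ a, E i a * x a) * ∑ a, E j a * y a)
      = ∑ a, x a * y a - (∑ a, ν a * x a) * ∑ a, ν a * y a := by
  have h : x ⬝ᵥ (E.transpose * G * E).mulVec y
      = x ⬝ᵥ (1 - Matrix.vecMulVec ν ν).mulVec y := by rw [hP]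
  rw [Matrix.sub_mulVec, Matrix.one_mulVec, Matrix.vecMulVec_mulVec, dotProduct_sub,
    ← Matrix.mulVec_mulVec, ← Matrix.mulVec_mulVec, Matrix.mulVec_transpose,
    dotProduct_comm, ← Matrix.dotProduct_mulVec, dotProduct_comm] at h
  simp only [dotProduct, Matrix.mulVec, Pi.smul_apply, MulOpposite.smul_eq_mul_unop,
    MulOpposite.unop_op] at h
  calc ∑ i, ∑ j, G i j * ((∑ a, E i a * x a) * ∑ a, E j a * y a)
      = ∑ i, (∑ a, E i a * x a) * ∑ j, G i j * ∑ a, E j a * y a := by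
        refine Finset.sum_congr rfl fun i _ => ?_
        rw [Finset.mul_sum]
        exact Finset.sum_congr rfl fun j _ => by ring
    _ = _ := by
        rw [h, Finset.sum_mul]
        congr 1
        exact Finset.sum_congr rfl fun a _ => by ring

theorem eq_vecMulVec_add_vecMulVec_of_mul_mul_transpose_eq_zero [DecidableEq ι]
    {E : Matrix κ ι R} {G : Matrix κ κ R} {ν : ι → R}
    (hP : E.transpose * G * E = 1 - Matrix.vecMulVec ν ν) {M : Matrix ι ι R}
    (hM : E * M * E.transpose = 0) (hνMν : Matrix.vecMul ν M ⬝ᵥ ν = 0) :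
    M = Matrix.vecMulVec ν (Matrix.vecMul ν M) + Matrix.vecMulVec (M.mulVec ν) ν := by
  have h : (E.transpose * G * E) * M * (E.transpose * G * E) = 0 := by
    calc (E.transpose * G * E) * M * (E.transpose * G * E)
        = E.transpose * G * (E * M * E.transpose) * (G * E) := by
          simp only [Matrix.mul_assoc]
      _ = 0 := by rw [hM, Matrix.mul_zero, Matrix.zero_mul]
  rw [hP, Matrix.sub_mul, Matrix.one_mul, Matrix.mul_sub, Matrix.mul_one, Matrix.sub_mul,
    Matrix.vecMulVec_mul, Matrix.mul_vecMulVec, Matrix.vecMulVec_mul_vecMulVec, hνMν] at h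
  rw [← sub_eq_zero, ← h]
  simp
  abel

omit [Fintype κ] in
theorem mul_mul_transpose_apply (E : Matrix κ ι R) (X : Matrix ι ι R) (i j : κ) :
    (E * X * E.transpose) i j = ∑ a, E i a * ∑ b, E j b * X a b := by
  simp only [Matrix.mul_apply, Matrix.transpose_apply, Finset.mul_sum, Finset.sum_mul]
  rw [Finset.sum_comm]
  exact Finset.sum_congr rfl fun a _ => Finset.sum_congr rfl fun b _ => by ring

omit [Fintype κ] in
theorem mul_sub_transpose_mul_transpose_eq_zero {E : Matrix κ ι R} {X : Matrix ι ι R}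
    (h : ∀ i j, (E * X * E.transpose) i j = (E * X * E.transpose) j i) :
    E * (X - X.transpose) * E.transpose = 0 := by
  have ht : (E * X * E.transpose).transpose = E * X.transpose * E.transpose := by
    simp only [Matrix.transpose_mul, Matrix.transpose_transpose, Matrix.mul_assoc]
  rw [Matrix.mul_sub, Matrix.sub_mul, ← ht, sub_eq_zero]
  ext i j
  exact h i j

end Frame

section Frame

variable {R ι κ : Type*} [CommRing R] [Algebra ℝ R] [Fintype ι] [Fintype κ]

/-- The tangential derivation `δ_a = g^{ij} e_i^a D_j`, the `a`-th ambient component of the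
tangential gradient. -/
def tangentialDerivation (D : κ → Derivation ℝ R R) (E : Matrix κ ι R) (G : Matrix κ κ R)
    (a : ι) : Derivation ℝ R R :=
  ∑ i, ∑ j, (G i j * E i a) • D j

omit [Fintype ι] in
theorem tangentialDerivation_apply (D : κ → Derivation ℝ R R) (E : Matrix κ ι R)
    (G : Matrix κ κ R) (a : ι) (f : R) :
    tangentialDerivation D E G a f = ∑ i, ∑ j, G i j * E i a * D j f := by
  have h : ∀ (s : Finset κ) (X : κ → Derivation ℝ R R), (∑ i ∈ s, X i) f = ∑ i ∈ s, X i f :=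
    fun s X => map_sum ((AddMonoidHom.eval f).comp
      (AddMonoidHom.mk' (fun d : Derivation ℝ R R => (d : R →+ R)) fun _ _ => rfl)) _ _
  simp only [tangentialDerivation, h, Derivation.smul_apply, smul_eq_mul]

variable {D : κ → Derivation ℝ R R} {E : Matrix κ ι R} {G : Matrix κ κ R} {ν : ι → R}

local notation "δ" => tangentialDerivation D E G

theorem sum_mul_tangentialDerivation [DecidableEq κ] (hG : E * E.transpose * G = 1) (i : κ)
    (f : R) : ∑ a, E i a * δ a f = D i f := by
  calc ∑ a, E i a * δ a f = ((E * E.transpose * G).mulVec fun j => D j f) i := by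
        simp only [tangentialDerivation_apply, Finset.mul_sum, Matrix.mulVec, dotProduct,
          Matrix.mul_apply, Finset.sum_mul, Matrix.transpose_apply]
        rw [Finset.sum_comm]
        rw [Finset.sum_comm (f := fun (k : κ) (l : κ) => ∑ a, E i a * E l a * G l k * D k f)]
        refine Finset.sum_congr rfl fun k _ => ?_
        rw [Finset.sum_comm]
        exact Finset.sum_congr rfl fun l _ => Finset.sum_congr rfl fun a _ => by ring
    _ = D i f := by rw [hG, Matrix.one_mulVec]

theorem sum_normal_mul_tangentialDerivation (horth : E.mulVec ν = 0) (f : R) :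
    ∑ a, ν a * δ a f = 0 := by
  simp only [tangentialDerivation_apply, Finset.mul_sum]
  rw [Finset.sum_comm]
  refine Finset.sum_eq_zero fun i _ => ?_
  rw [Finset.sum_comm]
  refine Finset.sum_eq_zero fun j _ => ?_
  calc ∑ a, ν a * (G i j * E i a * D j f) = E.mulVec ν i * (G i j * D j f) := by
        simp only [Matrix.mulVec, dotProduct, Finset.sum_mul]
        exact Finset.sum_congr rfl fun a _ => by ring
    _ = 0 := by rw [horth, Pi.zero_apply, zero_mul]

theorem covariantHessian_eq [DecidableEq κ] (hG : E * E.transpose * G = 1)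
    (hGs : ∀ i j, G i j = G j i) (i j : κ) (f : R) :
    D i (D j f) - ∑ k, (∑ l, G k l * ∑ a, D i (E j a) * E l a) * D k f
      = ∑ a, E i a * ∑ b, E j b * δ a (δ b f) := by
  have h : ∑ k, (∑ l, G k l * ∑ a, D i (E j a) * E l a) * D k f
      = ∑ b, D i (E j b) * δ b f := by
    simp only [tangentialDerivation_apply, Finset.mul_sum, Finset.sum_mul]
    rw [Finset.sum_comm]
    rw [Finset.sum_comm (s := (Finset.univ : Finset ι))]
    refine Finset.sum_congr rfl fun l _ => ?_
    rw [Finset.sum_comm (s := (Finset.univ : Finset ι))]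
    exact Finset.sum_congr rfl fun k _ => Finset.sum_congr rfl fun a _ => by
      rw [hGs k l]; ring
  rw [h, ← sum_mul_tangentialDerivation hG j f]
  simp only [map_sum, Derivation.leibniz, smul_eq_mul, Finset.sum_add_distrib, Finset.mul_sum,
    ← sum_mul_tangentialDerivation hG i (δ _ f)]
  rw [Finset.sum_comm]
  simp only [mul_comm (δ _ f), add_sub_cancel_right, mul_left_comm]

variable [DecidableEq ι] [DecidableEq κ]

theorem tangentialDerivation_comm (hG : E * E.transpose * G = 1)
    (hGs : ∀ i j, G i j = G j i) (hP : E.transpose * G * E = 1 - Matrix.vecMulVec ν ν)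
    (horth : E.mulVec ν = 0)
    (hD : ∀ i j f, D i (D j f) = D j (D i f)) (hE : ∀ i j a, D i (E j a) = D j (E i a))
    (a b : ι) (f : R) :
    δ a (δ b f) = δ b (δ a f) + ν a * ∑ c, δ b (ν c) * δ c f - ν b * ∑ c, δ a (ν c) * δ c f := by
  let M : Matrix ι ι R := Matrix.of fun a b => δ a (δ b f) - δ b (δ a f)
  have h1 : ∀ a, ∑ b, ν b * δ b f = 0 → ∑ b, ν b * δ a (δ b f) = -∑ b, δ a (ν b) * δ b f :=
    fun a h => by
      have := congrArg (δ a) h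
      simp only [map_sum, Derivation.leibniz, smul_eq_mul, Finset.sum_add_distrib,
        map_zero] at this
      rw [eq_neg_iff_add_eq_zero, ← this]
      simp only [mul_comm]
  have h2 : ∀ f, ∑ b, ν b * δ b f = 0 := sum_normal_mul_tangentialDerivation horth
  have hMν : M.mulVec ν = fun a => -∑ c, δ a (ν c) * δ c f := by
    ext a
    rw [← h1 a (h2 f), ← sub_zero (∑ b, ν b * δ a (δ b f)), ← h2 (δ a f),
      ← Finset.sum_sub_distrib]
    exact Finset.sum_congr rfl fun b _ => by simp only [M, Matrix.of_apply]; ring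
  have hνM : Matrix.vecMul ν M = fun b => ∑ c, δ b (ν c) * δ c f := by
    ext b
    rw [← neg_neg (∑ c, δ b (ν c) * δ c f), ← h1 b (h2 f), ← zero_sub, ← h2 (δ b f),
      ← Finset.sum_sub_distrib]
    exact Finset.sum_congr rfl fun b _ => by simp only [M, Matrix.of_apply]; ring
  have hM : E * M * E.transpose = 0 := by
    refine mul_sub_transpose_mul_transpose_eq_zero
      (X := Matrix.of fun a b => δ a (δ b f)) fun i j => ?_
    simp only [mul_mul_transpose_apply, Matrix.of_apply, ← covariantHessian_eq hG hGs, hD i j,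
      hE i j]
  have h := eq_vecMulVec_add_vecMulVec_of_mul_mul_transpose_eq_zero hP hM (by
    rw [hνM]
    simp only [dotProduct, Finset.sum_mul]
    rw [Finset.sum_comm]
    refine Finset.sum_eq_zero fun c _ => ?_
    calc ∑ b, δ b (ν c) * δ c f * ν b = (∑ b, ν b * δ b (ν c)) * δ c f := by
          rw [Finset.sum_mul]; exact Finset.sum_congr rfl fun _ _ => by ring
      _ = 0 := by rw [sum_normal_mul_tangentialDerivation horth, zero_mul])
  have hab := congrFun (congrFun h a) b
  rw [hνM, hMν] at hab
  simp only [Matrix.add_apply, Matrix.vecMulVec_apply, M, Matrix.of_apply] at hab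
  linear_combination hab

theorem tangentialDerivation_normal_symm (hG : E * E.transpose * G = 1)
    (hP : E.transpose * G * E = 1 - Matrix.vecMulVec ν ν) (horth : E.mulVec ν = 0)
    (hunit : ∑ a, ν a * ν a = 1) (hE : ∀ i j a, D i (E j a) = D j (E i a)) (a b : ι) :
    δ a (ν b) = δ b (ν a) := by
  let M : Matrix ι ι R := Matrix.of fun a b => δ a (ν b) - δ b (ν a)
  have h1 : ∀ a, ∑ b, ν b * δ a (ν b) = 0 := fun a =>
    sum_mul_derivation_eq_zero_of_unit hunit (δ a)
  have h2 : ∀ a, ∑ b, ν b * δ b (ν a) = 0 := fun a =>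
    sum_normal_mul_tangentialDerivation horth _
  have hMν : M.mulVec ν = 0 := by
    ext a
    simp only [M, Matrix.mulVec, dotProduct, Matrix.of_apply, mul_comm _ (ν _), mul_sub,
      Finset.sum_sub_distrib, h1, h2, sub_zero, Pi.zero_apply]
  have hνM : Matrix.vecMul ν M = 0 := by
    ext a
    simp only [M, Matrix.vecMul, dotProduct, Matrix.of_apply, mul_sub, Finset.sum_sub_distrib,
      h1, h2, sub_zero, Pi.zero_apply]
  have hM : E * M * E.transpose = 0 := by
    have hx : ∀ i j, ∑ b, E j b * D i (ν b) = -∑ b, ν b * D i (E j b) := fun i j => by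
      have := congrArg (D i) (congrFun horth j)
      simp only [Matrix.mulVec, dotProduct, map_sum, Derivation.leibniz, smul_eq_mul,
        Finset.sum_add_distrib, Pi.zero_apply, map_zero] at this
      rwa [eq_neg_iff_add_eq_zero]
    have hy : ∀ i j, ∑ a, E i a * ∑ b, E j b * δ a (ν b) = ∑ b, E j b * D i (ν b) :=
      fun i j => by
        simp only [← sum_mul_tangentialDerivation hG i, Finset.mul_sum]
        rw [Finset.sum_comm]
        simp only [mul_left_comm]
    refine mul_sub_transpose_mul_transpose_eq_zero
      (X := Matrix.of fun a b => δ a (ν b)) fun i j => ?_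
    simp only [mul_mul_transpose_apply, Matrix.of_apply, hy, hx, hE i j]
  have h := eq_vecMulVec_add_vecMulVec_of_mul_mul_transpose_eq_zero hP hM (by
    rw [hνM, zero_dotProduct])
  have hab := congrFun (congrFun h a) b
  rw [hνM, hMν] at hab
  simp only [Matrix.add_apply, Matrix.vecMulVec_apply, M, Matrix.of_apply, Pi.zero_apply,
    mul_zero, zero_mul, add_zero] at hab
  exact sub_eq_zero.1 hab

omit [Algebra ℝ R] [DecidableEq ι] in
theorem metric_symm (hG : E * E.transpose * G = 1) (i j : κ) : G i j = G j i := by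
  have h : G.transpose = G := by
    have h1 := congrArg Matrix.transpose hG
    simp only [Matrix.transpose_mul, Matrix.transpose_transpose, Matrix.transpose_one] at h1
    exact left_inv_eq_right_inv h1 hG
  exact congrFun (congrFun h j) i

omit [DecidableEq ι] [DecidableEq κ] in
theorem sum_metric_mul_derivation (hGs : ∀ i j, G i j = G j i) (x : ι → R) :
    ∑ i, ∑ j, G i j * ∑ b, E j b * D i (x b) = ∑ b, δ b (x b) := by
  simp only [tangentialDerivation_apply, Finset.mul_sum]
  rw [Finset.sum_comm, Finset.sum_comm (s := (Finset.univ : Finset ι))]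
  refine Finset.sum_congr rfl fun i _ => ?_
  rw [Finset.sum_comm (s := (Finset.univ : Finset ι))]
  exact Finset.sum_congr rfl fun j _ => Finset.sum_congr rfl fun b _ => by rw [hGs i j]; ring

omit [DecidableEq ι] in
theorem laplacian_eq_sum_tangentialDerivation (hG : E * E.transpose * G = 1) (f : R) :
    ∑ i, ∑ j, G i j * (D i (D j f)
        - ∑ k, (∑ l, G k l * ∑ a, D i (E j a) * E l a) * D k f)
      = ∑ a, δ a (δ a f) := by
  rw [← sum_metric_mul_derivation (metric_symm hG)]
  refine Finset.sum_congr rfl fun i _ => Finset.sum_congr rfl fun j _ => ?_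
  rw [covariantHessian_eq hG (metric_symm hG)]
  congr 1
  simp only [← sum_mul_tangentialDerivation hG i, Finset.mul_sum]
  rw [Finset.sum_comm]
  simp only [mul_left_comm]

omit [Algebra ℝ R] [DecidableEq κ] in
theorem sum_metric_metric_mul_eq (hP : E.transpose * G * E = 1 - Matrix.vecMulVec ν ν)
    {X : ι → ι → R} (hX : ∀ b, ∑ a, ν a * X a b = 0) :
    ∑ i, ∑ j, ∑ k, ∑ l, G i k * G j l *
        ((∑ a, E i a * ∑ b, E j b * X a b) * ∑ a, E k a * ∑ b, E l b * X a b)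
      = ∑ a, ∑ b, X a b * X a b - ∑ a, (∑ b, ν b * X a b) * ∑ b, ν b * X a b := by
  have hν : ∀ j, ∑ a, ν a * ∑ b, E j b * X a b = 0 := fun j => by
    simp only [Finset.mul_sum]
    rw [Finset.sum_comm]
    refine Finset.sum_eq_zero fun b _ => ?_
    simp only [mul_left_comm (ν _), ← Finset.mul_sum, hX, mul_zero]
  have hmove : ∀ f : κ → κ → κ → κ → R, ∑ i, ∑ j, ∑ k, ∑ l, G i k * G j l * f i j k l
      = ∑ j, ∑ l, G j l * ∑ i, ∑ k, G i k * f i j k l := fun f => by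
    simp only [Finset.mul_sum]
    rw [Finset.sum_comm]
    refine Finset.sum_congr rfl fun j _ => ?_
    rw [Finset.sum_comm (f := fun l i => ∑ k, G j l * (G i k * f i j k l))]
    refine Finset.sum_congr rfl fun i _ => ?_
    rw [Finset.sum_comm]
    exact Finset.sum_congr rfl fun l _ => Finset.sum_congr rfl fun k _ => by ring
  have hmove' : ∀ z : κ → κ → ι → R, ∑ j, ∑ l, G j l * ∑ a, z j l a
      = ∑ a, ∑ j, ∑ l, G j l * z j l a := fun z => by
    simp only [Finset.mul_sum]
    rw [Finset.sum_comm (s := (Finset.univ : Finset ι))]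
    refine Finset.sum_congr rfl fun j _ => ?_
    rw [Finset.sum_comm]
  rw [hmove]
  simp only [sum_metric_mul_eq hP, hν, mul_zero, sub_zero]
  rw [hmove']
  simp only [sum_metric_mul_eq hP, Finset.sum_sub_distrib]

theorem bochner_of_commuting_derivations (hcard : Fintype.card ι = Fintype.card κ + 1)
    (hG : E * E.transpose * G = 1) (horth : ∀ i, ∑ a, E i a * ν a = 0)
    (hunit : ∑ a, ν a * ν a = 1)
    (hD : ∀ i j f, D i (D j f) = D j (D i f)) (hE : ∀ i j a, D i (E j a) = D j (E i a))
    {T : ι → R} {V : κ → R} {H N : R} {Γ : κ → κ → κ → R} {M : κ → κ → ι → R}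
    (hconst : ∀ i a, D i (T a) = 0)
    (hH : H = ∑ i, ∑ j, G i j * -∑ a, D i (E j a) * ν a)
    (hT : ∀ a, T a = ∑ i, V i * E i a + -H * ν a)
    (hΓ : ∀ k i j, Γ k i j = ∑ l, G k l * ∑ a, D i (E j a) * E l a)
    (hN : N = ∑ i, ∑ j, G i j * ∑ a, D i (ν a) * D j (ν a))
    (hM : ∀ i j a, M i j a = (D i (D j (ν a)) - ∑ k, Γ k i j * D k (ν a))
      - (∑ b, (D i (D j (ν b)) - ∑ k, Γ k i j * D k (ν b)) * ν b) * ν a) :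
    ∑ i, ∑ j, G i j * (D i (D j N) - ∑ k, Γ k i j * D k N)
      = 2 * (∑ i, ∑ j, ∑ k, ∑ l, G i k * G j l * ∑ a, M i j a * M k l a) - 2 * N ^ 2
        - ∑ i, V i * D i N := by
  have horth' : E.mulVec ν = 0 := funext horth
  have hP := transpose_mul_mul_eq_one_sub_vecMulVec hcard hG hunit horth'
  have hGs := metric_symm hG
  have hνδ : ∀ f, ∑ a, ν a * δ a f = 0 := sum_normal_mul_tangentialDerivation horth'
  have hsym := tangentialDerivation_normal_symm (D := D) hG hP horth' hunit hE
  have hδH : ∑ a, δ a (ν a) = H := by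
    rw [hH, ← sum_metric_mul_derivation hGs]
    refine Finset.sum_congr rfl fun i _ => Finset.sum_congr rfl fun j _ => ?_
    congr 1
    have := congrArg (D i) (horth j)
    simp only [map_sum, Derivation.leibniz, smul_eq_mul, Finset.sum_add_distrib, map_zero] at this
    rw [eq_neg_iff_add_eq_zero, ← this]
    simp only [mul_comm]
  have hTν : ∑ a, T a * ν a = -∑ a, δ a (ν a) := by
    have h0 : ∑ a, (∑ i, V i * E i a) * ν a = 0 := by
      simp only [Finset.sum_mul]
      rw [Finset.sum_comm]
      simp only [mul_assoc, ← Finset.mul_sum, horth, mul_zero, Finset.sum_const_zero]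
    simp only [hT, add_mul, Finset.sum_add_distrib, h0, mul_assoc, ← Finset.mul_sum, hunit, hδH]
    ring
  have hδN : N = ∑ a, ∑ b, δ a (ν b) * δ a (ν b) := by
    rw [hN, Finset.sum_comm (s := (Finset.univ : Finset ι))]
    calc _ = ∑ b, ∑ i, ∑ j, G i j * (D i (ν b) * D j (ν b)) := by
          simp only [Finset.mul_sum]
          rw [Finset.sum_comm (s := (Finset.univ : Finset ι))]
          refine Finset.sum_congr rfl fun i _ => ?_
          rw [Finset.sum_comm]
      _ = _ := by
          refine Finset.sum_congr rfl fun b _ => ?_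
          simp only [← sum_mul_tangentialDerivation hG _ (ν b), sum_metric_mul_eq hP, hνδ,
            mul_zero, sub_zero]
  have hδV : ∑ i, V i * D i N = ∑ a, T a * δ a N := by
    simp only [hT, add_mul, Finset.sum_add_distrib, mul_assoc, ← Finset.mul_sum, hνδ, mul_zero,
      add_zero, Finset.sum_mul, ← sum_mul_tangentialDerivation hG _ N]
    rw [Finset.sum_comm (s := (Finset.univ : Finset ι))]
    simp only [Finset.mul_sum]
  have hYν : ∀ a b, ∑ c, ν c * δ a (δ b (ν c)) = -∑ c, δ c (ν a) * δ c (ν b) := fun a b => by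
    rw [sum_mul_derivation_shape hunit]
    simp only [hsym a, hsym b]
  have hhess : ∀ i j f, D i (D j f) - ∑ k, Γ k i j * D k f
      = ∑ a, E i a * ∑ b, E j b * δ a (δ b f) := fun i j f => by
    simp only [hΓ, covariantHessian_eq hG hGs]
  have hlap : ∑ i, ∑ j, G i j * (D i (D j N) - ∑ k, Γ k i j * D k N) = ∑ a, δ a (δ a N) := by
    simp only [hΓ, laplacian_eq_sum_tangentialDerivation hG]
  have hhessν : ∀ i j, ∑ c, (∑ a, E i a * ∑ b, E j b * δ a (δ b (ν c))) * ν c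
      = -∑ a, E i a * ∑ b, E j b * ∑ c, δ c (ν a) * δ c (ν b) := fun i j => by
    simp only [← neg_eq_iff_eq_neg.2 (hYν _ _), Finset.mul_sum, Finset.sum_mul,
      mul_neg, Finset.sum_neg_distrib, neg_neg]
    rw [Finset.sum_comm]
    refine Finset.sum_congr rfl fun a _ => ?_
    rw [Finset.sum_comm]
    exact Finset.sum_congr rfl fun b _ => Finset.sum_congr rfl fun c _ => by ring
  have hMM : ∀ i j k l, ∑ c, M i j c * M k l c
      = ∑ c, ((∑ a, E i a * ∑ b, E j b * δ a (δ b (ν c)))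
          * ∑ a, E k a * ∑ b, E l b * δ a (δ b (ν c)))
        - (∑ a, E i a * ∑ b, E j b * ∑ c, δ c (ν a) * δ c (ν b))
          * ∑ a, E k a * ∑ b, E l b * ∑ c, δ c (ν a) * δ c (ν b) := fun i j k l => by
    have h : ∀ x y : ι → R, ∑ c, (x c - (∑ d, x d * ν d) * ν c) * (y c - (∑ d, y d * ν d) * ν c)
        = ∑ c, x c * y c - (∑ d, x d * ν d) * ∑ d, y d * ν d := fun x y => by
      calc _ = ∑ c, (x c * y c - (∑ d, y d * ν d) * (x c * ν c)
            - (∑ d, x d * ν d) * (y c * ν c)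
            + (∑ d, x d * ν d) * (∑ d, y d * ν d) * (ν c * ν c)) :=
            Finset.sum_congr rfl fun c _ => by ring
        _ = _ := by
          rw [Finset.sum_add_distrib, Finset.sum_sub_distrib, Finset.sum_sub_distrib,
            ← Finset.mul_sum, ← Finset.mul_sum, ← Finset.mul_sum, hunit]
          ring
    simp only [hM, hhess]
    rw [h, hhessν, hhessν, neg_mul_neg]
  have hnorm : ∑ i, ∑ j, ∑ k, ∑ l, G i k * G j l * ∑ a, M i j a * M k l a
      = ∑ a, ∑ b, ∑ c, δ a (δ b (ν c)) * δ a (δ b (ν c))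
          - 2 * ∑ a, ∑ b, (∑ c, δ c (ν a) * δ c (ν b)) * ∑ c, δ c (ν a) * δ c (ν b) := by
    have hQ : ∀ b, ∑ a, ν a * ∑ c, δ c (ν a) * δ c (ν b) = 0 := fun b => by
      simp only [Finset.mul_sum]
      rw [Finset.sum_comm]
      refine Finset.sum_eq_zero fun c _ => ?_
      simp only [← mul_assoc, ← Finset.sum_mul,
        sum_mul_derivation_eq_zero_of_unit hunit (δ c), zero_mul]
    have hQ' : ∀ a, ∑ b, ν b * ∑ c, δ c (ν a) * δ c (ν b) = 0 := fun a => by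
      simpa only [mul_comm (δ _ (ν a))] using hQ a
    have hY : ∀ a c, ∑ b, ν b * δ a (δ b (ν c)) = -∑ d, δ d (ν a) * δ d (ν c) := fun a c => by
      rw [← hYν]
      simp only [hsym _ c]
    have hmove : ∀ z : κ → κ → κ → κ → ι → R,
        ∑ i, ∑ j, ∑ k, ∑ l, G i k * G j l * ∑ c, z i j k l c
          = ∑ c, ∑ i, ∑ j, ∑ k, ∑ l, G i k * G j l * z i j k l c := fun z => by
      simp only [Finset.mul_sum]
      rw [Finset.sum_comm (s := (Finset.univ : Finset ι))]
      refine Finset.sum_congr rfl fun i _ => ?_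
      rw [Finset.sum_comm (s := (Finset.univ : Finset ι))]
      refine Finset.sum_congr rfl fun j _ => ?_
      rw [Finset.sum_comm (s := (Finset.univ : Finset ι))]
      refine Finset.sum_congr rfl fun k _ => ?_
      rw [Finset.sum_comm]
    have hYsq : ∑ c, ∑ a, ∑ b, δ a (δ b (ν c)) * δ a (δ b (ν c))
        = ∑ a, ∑ b, ∑ c, δ a (δ b (ν c)) * δ a (δ b (ν c)) := by
      rw [Finset.sum_comm]
      refine Finset.sum_congr rfl fun a _ => ?_
      rw [Finset.sum_comm]
    simp only [hMM, mul_sub, Finset.sum_sub_distrib]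
    rw [hmove]
    simp only [sum_metric_metric_mul_eq hP (X := fun a b => δ a (δ b (ν _))) fun b => hνδ _,
      sum_metric_metric_mul_eq hP hQ, hQ', hY, neg_mul_neg, mul_zero, Finset.sum_const_zero,
      Finset.sum_sub_distrib, hYsq]
    rw [Finset.sum_comm (f := fun c a =>
      (∑ d, δ d (ν a) * δ d (ν c)) * ∑ d, δ d (ν a) * δ d (ν c))]
    ring
  rw [hlap, hnorm, hδV, hδN]
  exact tangential_bochner hνδ hunit hsym (fun a b f => by
    rw [tangentialDerivation_comm hG hGs hP horth' hD hE]
    simp only [hsym]) (fun a b => by simp [tangentialDerivation_apply, hconst]) hTν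

end Frame

section SmoothFunctions

variable {n : ℕ}

/-- The algebra of smooth functions on `ℝⁿ`. -/
def smoothFunctions (n : ℕ) : Subalgebra ℝ ((Fin n → ℝ) → ℝ) where
  carrier := {f | ContDiff ℝ (⊤ : ℕ∞) f}
  mul_mem' {f g} (hf : ContDiff ℝ (⊤ : ℕ∞) f) (hg : ContDiff ℝ (⊤ : ℕ∞) g) := hf.mul hg
  add_mem' {f g} (hf : ContDiff ℝ (⊤ : ℕ∞) f) (hg : ContDiff ℝ (⊤ : ℕ∞) g) := hf.add hg
  algebraMap_mem' c := (contDiff_const : ContDiff ℝ (⊤ : ℕ∞) fun _ : Fin n → ℝ => c)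

theorem contDiff_smoothFunctions (f : smoothFunctions n) : ContDiff ℝ (⊤ : ℕ∞) f.1 :=
  f.2

theorem differentiableAt_smoothFunctions (f : smoothFunctions n) (x : Fin n → ℝ) :
    DifferentiableAt ℝ f.1 x :=
  (contDiff_smoothFunctions f).differentiable (by simp) x

theorem contDiff_fderiv_apply {E : Type*} [NormedAddCommGroup E] [NormedSpace ℝ E]
    {f : (Fin n → ℝ) → E} (hf : ContDiff ℝ (⊤ : ℕ∞) f) (v : Fin n → ℝ) :
    ContDiff ℝ (⊤ : ℕ∞) fun x => fderiv ℝ f x v :=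
  (hf.fderiv_right (m := ((⊤ : ℕ∞) : WithTop ℕ∞)) (by simp)).clm_apply contDiff_const

theorem pdr_comm {f : (Fin n → ℝ) → ℝ} (hf : ContDiff ℝ (⊤ : ℕ∞) f) (i j : Fin n)
    (x : Fin n → ℝ) : pdr i (fun y => pdr j f y) x = pdr j (fun y => pdr i f y) x := by
  have hd : DifferentiableAt ℝ (fderiv ℝ f) x :=
    (hf.fderiv_right (m := ((⊤ : ℕ∞) : WithTop ℕ∞)) (by simp)).differentiable (by simp) x
  have h : ∀ v w : Fin n → ℝ,
      fderiv ℝ (fun y => fderiv ℝ f y v) x w = fderiv ℝ (fderiv ℝ f) x w v := fun v w => by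
    rw [fderiv_clm_apply hd (differentiableAt_const v)]
    simp
  simp only [pdr, h]
  have h2 : (2 : WithTop ℕ∞) ≤ ((⊤ : ℕ∞) : WithTop ℕ∞) :=
    WithTop.coe_le_coe.2 (le_top : (2 : ℕ∞) ≤ ⊤)
  exact (hf.contDiffAt.isSymmSndFDerivAt (by simpa using h2)).eq _ _

theorem pdv_apply {m : ℕ} {f : (Fin n → ℝ) → EuclideanSpace ℝ (Fin m)}
    (hf : ContDiff ℝ (⊤ : ℕ∞) f) (i : Fin n) (x : Fin n → ℝ) (a : Fin m) :
    pdv i f x a = pdr i (fun y => f y a) x := by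
  have h := ((EuclideanSpace.proj a : EuclideanSpace ℝ (Fin m) →L[ℝ] ℝ).hasFDerivAt.comp x
    (hf.differentiable (by simp) x).hasFDerivAt).fderiv
  exact (congrArg (fun L : (Fin n → ℝ) →L[ℝ] ℝ => L (Pi.single i 1)) h).symm

/-- The partial derivative in direction `i`, as a derivation of the smooth functions. -/
def partialDerivation (i : Fin n) :
    Derivation ℝ (smoothFunctions n) (smoothFunctions n) :=
  Derivation.mk'
    { toFun := fun f => ⟨pdr i f.1, contDiff_fderiv_apply (contDiff_smoothFunctions f) _⟩
      map_add' := fun f g => Subtype.ext <| funext fun x => by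
        change fderiv ℝ (f.1 + g.1) x _ = fderiv ℝ f.1 x _ + fderiv ℝ g.1 x _
        rw [fderiv_add (differentiableAt_smoothFunctions f x)
          (differentiableAt_smoothFunctions g x)]
        rfl
      map_smul' := fun c f => Subtype.ext <| funext fun x => by
        change fderiv ℝ (c • f.1) x _ = c • fderiv ℝ f.1 x _
        rw [fderiv_const_smul (differentiableAt_smoothFunctions f x)]
        rfl }
    fun f g => Subtype.ext <| funext fun x => by
      change fderiv ℝ (f.1 * g.1) x _ = f.1 x * fderiv ℝ g.1 x _ + g.1 x * fderiv ℝ f.1 x _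
      rw [fderiv_mul (differentiableAt_smoothFunctions f x) (differentiableAt_smoothFunctions g x)]
      rfl

/-- Evaluation of smooth functions at a point. -/
def evalSmooth (x : Fin n → ℝ) : smoothFunctions n →+* ℝ :=
  (Pi.evalRingHom (fun _ : Fin n → ℝ => ℝ) x).comp (smoothFunctions n).val.toRingHom

theorem evalSmooth_ext {f g : smoothFunctions n} (h : ∀ x, evalSmooth x f = evalSmooth x g) :
    f = g :=
  Subtype.ext (funext h)

theorem evalSmooth_partialDerivation (i : Fin n) (f : smoothFunctions n) (x : Fin n → ℝ) :
    evalSmooth x (partialDerivation i f) = pdr i (fun y => evalSmooth y f) x :=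
  rfl

theorem partialDerivation_comm (i j : Fin n) (f : smoothFunctions n) :
    partialDerivation i (partialDerivation j f) = partialDerivation j (partialDerivation i f) :=
  evalSmooth_ext fun x => pdr_comm (contDiff_smoothFunctions f) i j x

/-- The `a`-th component of a smooth map. -/
def component {m : ℕ} {f : (Fin n → ℝ) → EuclideanSpace ℝ (Fin m)}
    (hf : ContDiff ℝ (⊤ : ℕ∞) f) (a : Fin m) : smoothFunctions n :=
  ⟨fun x => f x a, (EuclideanSpace.proj a : EuclideanSpace ℝ (Fin m) →L[ℝ] ℝ).contDiff.comp hf⟩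

theorem pdv_eq_evalSmooth {m : ℕ} {f : (Fin n → ℝ) → EuclideanSpace ℝ (Fin m)}
    (hf : ContDiff ℝ (⊤ : ℕ∞) f) (i : Fin n) (x : Fin n → ℝ) (a : Fin m) :
    pdv i f x a = evalSmooth x (partialDerivation i (component hf a)) :=
  pdv_apply hf i x a

theorem pdv_pdv_eq_evalSmooth {m : ℕ} {f : (Fin n → ℝ) → EuclideanSpace ℝ (Fin m)}
    (hf : ContDiff ℝ (⊤ : ℕ∞) f) (i j : Fin n) (x : Fin n → ℝ) (a : Fin m) :
    pdv i (fun y => pdv j f y) x a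
      = evalSmooth x (partialDerivation i (partialDerivation j (component hf a))) := by
  rw [pdv_apply (f := fun y => pdv j f y) (contDiff_fderiv_apply hf _)]
  simp only [pdv_apply hf]
  rfl

theorem euclidean_inner_eq_sum {m : ℕ} (x y : EuclideanSpace ℝ (Fin m)) :
    ⟪x, y⟫ = ∑ a, x a * y a := by
  simp [PiLp.inner_apply, mul_comm]

theorem contDiff_gmet_inv {F : (Fin n → ℝ) → EuclideanSpace ℝ (Fin (n + 1))}
    (hF : ContDiff ℝ (⊤ : ℕ∞) F) (himm : ∀ x, (gmet F x).det ≠ 0) (i j : Fin n) :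
    ContDiff ℝ (⊤ : ℕ∞) fun x => (gmet F x)⁻¹ i j := by
  have hg : ∀ i j, ContDiff ℝ (⊤ : ℕ∞) fun x => gmet F x i j := fun i j =>
    (contDiff_fderiv_apply hF _).inner ℝ (contDiff_fderiv_apply hF _)
  have hdet : ∀ A : (Fin n → ℝ) → Matrix (Fin n) (Fin n) ℝ,
      (∀ i j, ContDiff ℝ (⊤ : ℕ∞) fun x => A x i j) →
      ContDiff ℝ (⊤ : ℕ∞) fun x => (A x).det := fun A hA => by
    simp only [Matrix.det_apply]
    exact ContDiff.sum fun σ _ => (contDiff_prod fun k _ => hA _ _).const_smul _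
  simp only [Matrix.inv_def, Ring.inverse_eq_inv', Matrix.smul_apply, smul_eq_mul,
    Matrix.adjugate_apply]
  refine ((hdet _ hg).inv himm).mul (hdet _ fun k l => ?_)
  by_cases h : k = j
  · subst h
    simpa using contDiff_const
  · simpa [Matrix.updateRow_ne h] using hg k l

end SmoothFunctions

/-- Bochner formula for the Gauss map of a translating soliton:
Δ|∇u|² = 2|∇du|² - 2|∇u|⁴ - ⟨V, ∇|∇u|²⟩. -/
theorem bochner_formula_gauss_map
    {n : ℕ} (hn : 2 ≤ n)
    (F ν : (Fin n → ℝ) → EuclideanSpace ℝ (Fin (n + 1)))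
    (T : EuclideanSpace ℝ (Fin (n + 1)))
    (V : (Fin n → ℝ) → Fin n → ℝ) (hVsm : ContDiff ℝ (⊤ : ℕ∞) V)
    (hF : ContDiff ℝ (⊤ : ℕ∞) F) (hν : ContDiff ℝ (⊤ : ℕ∞) ν)
    (hunit : ∀ x, ‖ν x‖ = 1)
    (horth : ∀ x i, ⟪ν x, pdv i F x⟫ = 0)
    (himm : ∀ x, (gmet F x).det ≠ 0)
    (hsol : ∀ x, ⟪T, ν x⟫ = -meanCurv F ν x)
    (hdecomp : ∀ x, T = (∑ i, V x i • pdv i F x) + (-(meanCurv F ν x)) • ν x) :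
    ∀ x, lapS F (eDen F ν) x
      = 2 * mapHessNormSq F ν x - 2 * (eDen F ν x) ^ 2
        - ∑ i, V x i * pdr i (eDen F ν) x := by
  let D : Fin n → Derivation ℝ (smoothFunctions n) (smoothFunctions n) := partialDerivation
  let u := component hν
  let E : Matrix (Fin n) (Fin (n + 1)) (smoothFunctions n) :=
    Matrix.of fun i a => D i (component hF a)
  let G : Matrix (Fin n) (Fin n) (smoothFunctions n) :=
    Matrix.of fun i j => ⟨fun x => (gmet F x)⁻¹ i j, contDiff_gmet_inv hF himm i j⟩
  let W : Fin n → smoothFunctions n := fun i => ⟨fun x => V x i, contDiff_pi.1 hVsm i⟩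
  let H : smoothFunctions n := ∑ i, ∑ j, G i j * -∑ a, D i (E j a) * u a
  let N : smoothFunctions n := ∑ i, ∑ j, G i j * ∑ a, D i (u a) * D j (u a)
  let Γ : Fin n → Fin n → Fin n → smoothFunctions n :=
    fun k i j => ∑ l, G k l * ∑ a, D i (E j a) * E l a
  let M : Fin n → Fin n → Fin (n + 1) → smoothFunctions n := fun i j a =>
    (D i (D j (u a)) - ∑ k, Γ k i j * D k (u a))
      - (∑ b, (D i (D j (u b)) - ∑ k, Γ k i j * D k (u b)) * u b) * u a
  have hu : ∀ x a, evalSmooth x (u a) = ν x a := fun _ _ => rfl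
  have hDu : ∀ x i a, evalSmooth x (D i (u a)) = pdv i ν x a := fun x i a =>
    (pdv_eq_evalSmooth hν i x a).symm
  have hDDu : ∀ x i j a, evalSmooth x (D i (D j (u a))) = pdv i (fun y => pdv j ν y) x a :=
    fun x i j a => (pdv_pdv_eq_evalSmooth hν i j x a).symm
  have hEx : ∀ x i a, evalSmooth x (E i a) = pdv i F x a := fun x i a =>
    (pdv_eq_evalSmooth hF i x a).symm
  have hDE : ∀ x i j a, evalSmooth x (D i (E j a)) = pdv i (fun y => pdv j F y) x a :=
    fun x i j a => (pdv_pdv_eq_evalSmooth hF i j x a).symm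
  have hGx : ∀ x i j, evalSmooth x (G i j) = (gmet F x)⁻¹ i j := fun _ _ _ => rfl
  have hHx : ∀ x, evalSmooth x H = meanCurv F ν x := fun x => by
    simp only [H, map_sum, map_mul, map_neg, hGx, hDE, hu, meanCurv, sff,
      euclidean_inner_eq_sum]
  have hNx : ∀ x, evalSmooth x N = eDen F ν x := fun x => by
    simp only [N, map_sum, map_mul, hGx, hDu, eDen, euclidean_inner_eq_sum]
  have hΓx : ∀ x k i j, evalSmooth x (Γ k i j) = chr F x k i j := fun x k i j => by
    simp only [Γ, map_sum, map_mul, hGx, hDE, hEx, chr, euclidean_inner_eq_sum]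
  have hMx : ∀ x i j a, evalSmooth x (M i j a) = mapHess F ν x i j a := fun x i j a => by
    simp only [M, map_sum, map_mul, map_sub, hDDu, hΓx, hDu, hu, mapHess,
      euclidean_inner_eq_sum, PiLp.sub_apply, PiLp.smul_apply, smul_eq_mul,
      WithLp.ofLp_sum, Finset.sum_apply]
  have hG : E * E.transpose * G = 1 := by
    ext i j : 1
    refine evalSmooth_ext fun x => ?_
    have h := congrFun (congrFun
      (Matrix.mul_nonsing_inv (gmet F x) (isUnit_iff_ne_zero.2 (himm x))) i) j
    simp only [Matrix.mul_apply, Matrix.transpose_apply, map_sum, map_mul, hEx, hGx] at h ⊢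
    simp only [gmet, Matrix.of_apply, euclidean_inner_eq_sum] at h ⊢
    rw [h]
    by_cases hij : i = j <;> simp [Matrix.one_apply, hij]
  have horthE : ∀ i, ∑ a, E i a * u a = 0 := fun i => evalSmooth_ext fun x => by
    have h := horth x i
    rw [real_inner_comm, euclidean_inner_eq_sum] at h
    simpa only [map_sum, map_mul, hEx, hu, map_zero] using h
  have hunitu : ∑ a, u a * u a = 1 := evalSmooth_ext fun x => by
    have h : ⟪ν x, ν x⟫ = 1 := by rw [real_inner_self_eq_norm_sq, hunit, one_pow]
    rw [euclidean_inner_eq_sum] at h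
    simpa only [map_sum, map_mul, hu, map_one] using h
  have hT : ∀ a, algebraMap ℝ (smoothFunctions n) (T a) = ∑ i, W i * E i a + -H * u a :=
    fun a => evalSmooth_ext fun x => by
      have h := congrArg (fun v : EuclideanSpace ℝ (Fin (n + 1)) => v a) (hdecomp x)
      simp only [PiLp.add_apply, PiLp.smul_apply, smul_eq_mul, WithLp.ofLp_sum,
        Finset.sum_apply] at h
      simp only [map_add, map_sum, map_mul, map_neg, hEx, hHx, hu]
      exact h
  have key := bochner_of_commuting_derivations (by simp) hG horthE hunitu
    partialDerivation_comm (fun i j a => partialDerivation_comm i j _)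
    (fun i a => (D i).map_algebraMap (T a)) (H := H) rfl hT (Γ := Γ) (fun _ _ _ => rfl)
    (N := N) rfl (M := M) (fun _ _ _ => rfl)
  intro x
  have hx := congrArg (evalSmooth x) key
  simp only [map_sub, map_sum, map_mul, map_pow, map_ofNat,
    evalSmooth_partialDerivation, hNx, hΓx, hMx, hGx] at hx
  simp only [lapS, mapHessNormSq, euclidean_inner_eq_sum]
  exact hx

end
end

section
/- Let Σ ⊂ ℝ^{n+1} (n ≥ 2) be a complete translating soliton with bounded mean curvature. If the image of its Gauss map u lies in a geodesic ball B_Λ(y₀) ⊂ S^n of radius Λ < π/2, then Σ is a hyperplane. -/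
open scoped BigOperators RealInnerProductSpace
open Real

noncomputable section

/-- Induced Riemannian distance on Σ: infimum of lengths of C¹ paths. -/
def indDist {n : ℕ} (F : (Fin n → ℝ) → EuclideanSpace ℝ (Fin (n + 1)))
    (x y : Fin n → ℝ) : ℝ :=
  sInf {L | ∃ γ : ℝ → Fin n → ℝ, ContDiff ℝ 1 γ ∧ γ 0 = x ∧ γ 1 = y ∧
    L = ∫ t in (0:ℝ)..1, ‖fderiv ℝ (F ∘ γ) t 1‖}

/-- `f` is differentiable on the line, and twice at `0`, with value `a`, velocity `b` and
acceleration `c` there. -/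
def Jet2 {V : Type*} [NormedAddCommGroup V] [NormedSpace ℝ V] (f : ℝ → V) (a b c : V) : Prop :=
  f 0 = a ∧ ∃ f' : ℝ → V, (∀ t, HasDerivAt f (f' t) t) ∧ f' 0 = b ∧ HasDerivAt f' c 0

namespace Jet2

variable {V W Z : Type*} [NormedAddCommGroup V] [NormedSpace ℝ V]
  [NormedAddCommGroup W] [NormedSpace ℝ W] [NormedAddCommGroup Z] [NormedSpace ℝ Z]

theorem const (a : V) : Jet2 (fun _ => a) a 0 0 :=
  ⟨rfl, fun _ => 0, fun t => hasDerivAt_const t a, rfl, hasDerivAt_const 0 0⟩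

theorem quadratic (a b c : V) :
    Jet2 (fun t : ℝ => a + t • b + (t ^ 2 / 2) • c) a b c := by
  refine ⟨by simp, fun t => b + t • c, fun t => ?_, by simp, ?_⟩
  · have h1 := ((hasDerivAt_id t).smul_const b).const_add a
    have h2 := ((((hasDerivAt_id t).pow 2).div_const 2).smul_const c)
    have := h1.add h2
    simpa using! this
  · simpa using ((hasDerivAt_id (0:ℝ)).smul_const c).const_add b

theorem add {f g : ℝ → V} {a b c a' b' c' : V} (hf : Jet2 f a b c) (hg : Jet2 g a' b' c') :
    Jet2 (fun t => f t + g t) (a + a') (b + b') (c + c') := by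
  obtain ⟨h0, f', h1, h2, h3⟩ := hf
  obtain ⟨k0, g', k1, k2, k3⟩ := hg
  exact ⟨by simp [h0, k0], fun t => f' t + g' t, fun t => (h1 t).add (k1 t), by simp [h2, k2],
    h3.add k3⟩

theorem clm_comp (L : V →L[ℝ] W) {f : ℝ → V} {a b c : V} (hf : Jet2 f a b c) :
    Jet2 (fun t => L (f t)) (L a) (L b) (L c) := by
  obtain ⟨h0, f', h1, h2, h3⟩ := hf
  exact ⟨by simp [h0], fun t => L (f' t), fun t => L.hasFDerivAt.comp_hasDerivAt t (h1 t),
    by simp [h2], L.hasFDerivAt.comp_hasDerivAt 0 h3⟩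

theorem clm_apply {f : ℝ → V →L[ℝ] W} {g : ℝ → V} {a b c : V →L[ℝ] W} {a' b' c' : V}
    (hf : Jet2 f a b c) (hg : Jet2 g a' b' c') :
    Jet2 (fun t => f t (g t)) (a a') (b a' + a b') (c a' + b b' + b b' + a c') := by
  obtain ⟨h0, f', h1, h2, h3⟩ := hf
  obtain ⟨k0, g', k1, k2, k3⟩ := hg
  refine ⟨by simp [h0, k0], fun t => f' t (g t) + f t (g' t), fun t => (h1 t).clm_apply (k1 t),
    by simp [h0, h2, k0, k2], ?_⟩
  have := (h3.clm_apply (k1 0)).add ((h1 0).clm_apply k3)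
  rw [h0, h2, k0, k2] at this
  convert! this using 1
  abel

theorem mul {f g : ℝ → ℝ} {a b c a' b' c' : ℝ} (hf : Jet2 f a b c) (hg : Jet2 g a' b' c') :
    Jet2 (fun t => f t * g t) (a * a') (b * a' + a * b') (c * a' + 2 * (b * b') + a * c') := by
  have := (hf.clm_comp (ContinuousLinearMap.mul ℝ ℝ)).clm_apply hg
  simp only [ContinuousLinearMap.mul_apply'] at this
  convert this using 1
  ring

theorem inner {E : Type*} [NormedAddCommGroup E] [InnerProductSpace ℝ E] {f g : ℝ → E}
    {a b c a' b' c' : E} (hf : Jet2 f a b c) (hg : Jet2 g a' b' c') :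
    Jet2 (fun t => ⟪f t, g t⟫) ⟪a, a'⟫ (⟪b, a'⟫ + ⟪a, b'⟫)
      (⟪c, a'⟫ + 2 * ⟪b, b'⟫ + ⟪a, c'⟫) := by
  have := (hf.clm_comp (innerSL ℝ)).clm_apply hg
  change Jet2 (fun t => ⟪f t, g t⟫) ⟪a, a'⟫ (⟪b, a'⟫ + ⟪a, b'⟫)
    (⟪c, a'⟫ + ⟪b, b'⟫ + ⟪b, b'⟫ + ⟪a, c'⟫) at this
  rwa [add_assoc ⟪c, a'⟫, ← two_mul] at this

theorem sum {ι : Type*} (s : Finset ι) {f : ι → ℝ → V} {a b c : ι → V}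
    (hf : ∀ i ∈ s, Jet2 (f i) (a i) (b i) (c i)) :
    Jet2 (fun t => ∑ i ∈ s, f i t) (∑ i ∈ s, a i) (∑ i ∈ s, b i) (∑ i ∈ s, c i) := by
  classical
  induction s using Finset.induction_on with
  | empty => simpa using const (0 : V)
  | insert i s hi ih =>
    simp only [Finset.sum_insert hi]
    exact (hf i (Finset.mem_insert_self i s)).add
      (ih fun j hj => hf j (Finset.mem_insert_of_mem hj))

theorem comp {φ : V → W} (hφ : ContDiff ℝ (⊤ : ℕ∞) φ) {f : ℝ → V} {a b c : V}
    (hf : Jet2 f a b c) :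
    Jet2 (fun t => φ (f t)) (φ a) (fderiv ℝ φ a b)
      (fderiv ℝ (fderiv ℝ φ) a b b + fderiv ℝ φ a c) := by
  obtain ⟨h0, f', h1, h2, h3⟩ := hf
  have d1 : Differentiable ℝ φ := hφ.differentiable (by simp)
  have d2 : Differentiable ℝ (fderiv ℝ φ) :=
    (hφ.fderiv_right (m := (⊤ : ℕ∞)) (by simp)).differentiable (by simp)
  refine ⟨by simp [h0], fun t => fderiv ℝ φ (f t) (f' t), fun t =>
    (d1 _).hasFDerivAt.comp_hasDerivAt t (h1 t), by simp [h0, h2], ?_⟩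
  have := ((d2 (f 0)).hasFDerivAt.comp_hasDerivAt 0 (h1 0)).clm_apply h3
  rw [h0, h2] at this
  simpa [h0, h2] using! this

theorem unique {f : ℝ → V} {a b c a' b' c' : V} (hf : Jet2 f a b c) (hf' : Jet2 f a' b' c') :
    a = a' ∧ b = b' ∧ c = c' := by
  obtain ⟨h0, g, h1, h2, h3⟩ := hf
  obtain ⟨k0, g', k1, k2, k3⟩ := hf'
  obtain rfl : g = g' := funext fun t => (h1 t).unique (k1 t)
  exact ⟨h0.symm.trans k0, h2.symm.trans k2, h3.unique k3⟩

theorem nonpos_of_isLocalMax {f : ℝ → ℝ} {a b c : ℝ} (hf : Jet2 f a b c)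
    (hmax : IsLocalMax f 0) : c ≤ 0 := by
  obtain ⟨h0, f', h1, h2, h3⟩ := hf
  by_contra! hc
  have e : deriv f = f' := funext fun t => (h1 t).deriv
  have hz : deriv f 0 = 0 := hmax.deriv_eq_zero
  have hmin : IsLocalMin f 0 := by
    refine isLocalMin_of_deriv_deriv_pos ?_ hz (h1 0).continuousAt
    rw [e, h3.deriv]; exact hc
  have hconst : f =ᶠ[nhds 0] fun _ => f 0 := by
    filter_upwards [hmax, hmin] with t h h' using le_antisymm h h'
  have h4 : f' =ᶠ[nhds 0] fun _ => 0 := by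
    rw [← e]
    simpa using hconst.deriv
  exact hc.ne' (h3.unique ((hasDerivAt_const (0:ℝ) (0:ℝ)).congr_of_eventuallyEq h4))

end Jet2

section Frame

variable {E : Type*} [NormedAddCommGroup E] [InnerProductSpace ℝ E] {ι : Type*} [Fintype ι]

/-- The image of an orthonormal basis under the square root of `1 - v ⊗ v / (1 + ‖v‖²)`. -/
def tiltedFrame (b : OrthonormalBasis ι ℝ E) (v : E) (i : ι) : E :=
  b i - ((√(1 + ‖v‖ ^ 2) * (√(1 + ‖v‖ ^ 2) + 1))⁻¹ * ⟪v, b i⟫) • v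

theorem sum_tiltedFrame (b : OrthonormalBasis ι ℝ E) (v : E) (B : E →ₗ[ℝ] E →ₗ[ℝ] ℝ) :
    ∑ i, B (tiltedFrame b v i) (tiltedFrame b v i) =
      ∑ i, B (b i) (b i) - (1 + ‖v‖ ^ 2)⁻¹ * B v v := by
  have hw : 0 < 1 + ‖v‖ ^ 2 := by positivity
  set w := √(1 + ‖v‖ ^ 2) with hw'
  have hw2 : w ^ 2 = 1 + ‖v‖ ^ 2 := Real.sq_sqrt hw.le
  have hwpos : 0 < w := Real.sqrt_pos.mpr hw
  set κ := (w * (w + 1))⁻¹ with hκ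
  have hexp : ∀ i, B (tiltedFrame b v i) (tiltedFrame b v i) =
      B (b i) (b i) - κ * (B (⟪b i, v⟫ • b i) v) - κ * (B v (⟪b i, v⟫ • b i))
        + κ ^ 2 * (⟪v, b i⟫ * ⟪b i, v⟫) * B v v := by
    intro i
    simp only [tiltedFrame, ← hw', ← hκ, map_sub, map_smul, LinearMap.sub_apply,
      LinearMap.smul_apply, smul_eq_mul, real_inner_comm v (b i)]
    ring
  have h1 : ∑ i, B (⟪b i, v⟫ • b i) v = B v v := by
    simpa [map_sum, LinearMap.sum_apply] using congrArg (fun y => B y v) (b.sum_repr' v)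
  have h2 : ∑ i, B v (⟪b i, v⟫ • b i) = B v v := by
    rw [← map_sum, b.sum_repr' v]
  have h3 : ∑ i, ⟪v, b i⟫ * ⟪b i, v⟫ = ‖v‖ ^ 2 := by
    rw [b.sum_inner_mul_inner, real_inner_self_eq_norm_sq]
  rw [Finset.sum_congr rfl fun i _ => hexp i]
  simp only [Finset.sum_add_distrib, Finset.sum_sub_distrib, ← Finset.mul_sum, ← Finset.sum_mul,
    h1, h2, h3]
  have : κ * 2 - κ ^ 2 * ‖v‖ ^ 2 = (1 + ‖v‖ ^ 2)⁻¹ := by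
    rw [hκ, ← hw2, show ‖v‖ ^ 2 = w ^ 2 - 1 by linarith]
    field_simp
    ring
  rw [← this]; ring

theorem sum_inner_tiltedFrame_mul (b : OrthonormalBasis ι ℝ E) (v p q : E) :
    ∑ i, ⟪tiltedFrame b v i, p⟫ * ⟪tiltedFrame b v i, q⟫ =
      ⟪p, q⟫ - (1 + ‖v‖ ^ 2)⁻¹ * (⟪v, p⟫ * ⟪v, q⟫) := by
  have := sum_tiltedFrame b v (LinearMap.mk₂ ℝ (fun x y : E => ⟪x, p⟫ * ⟪y, q⟫)
    (fun _ _ _ => by rw [inner_add_left]; ring) (fun _ _ _ => by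
      simp only [inner_smul_left, smul_eq_mul, conj_trivial]; ring)
    (fun _ _ _ => by rw [inner_add_left]; ring) (fun _ _ _ => by
      simp only [inner_smul_left, smul_eq_mul, conj_trivial]; ring))
  simp only [LinearMap.mk₂_apply] at this
  rw [this]
  congr 1
  rw [← b.sum_inner_mul_inner p q]
  exact Finset.sum_congr rfl fun i _ => by rw [real_inner_comm]

theorem sum_inner_apply_tiltedFrame (b : OrthonormalBasis ι ℝ E) (v z : E)
    (B : E →L[ℝ] E →L[ℝ] E) :
    ∑ i, ⟪B (tiltedFrame b v i) (tiltedFrame b v i), z⟫ =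
      ∑ i, ⟪B (b i) (b i), z⟫ - (1 + ‖v‖ ^ 2)⁻¹ * ⟪B v v, z⟫ := by
  simpa using sum_tiltedFrame b v (LinearMap.mk₂ ℝ (fun x y : E => ⟪B x y, z⟫)
    (fun _ _ _ => by simp [inner_add_left]) (fun _ _ _ => by simp [inner_smul_left])
    (fun _ _ _ => by simp [inner_add_left]) (fun _ _ _ => by simp [inner_smul_left]))

end Frame

section Derivatives

variable {E : Type*} [NormedAddCommGroup E] [InnerProductSpace ℝ E] {v : E → E}

theorem contDiff_top_fderiv {V W : Type*} [NormedAddCommGroup V] [NormedSpace ℝ V]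
    [NormedAddCommGroup W] [NormedSpace ℝ W] {f : V → W} (hf : ContDiff ℝ (⊤ : ℕ∞) f) :
    ContDiff ℝ (⊤ : ℕ∞) (fderiv ℝ f) :=
  hf.fderiv_right (by simp)

theorem fderiv_fderiv_comm {V W : Type*} [NormedAddCommGroup V] [NormedSpace ℝ V]
    [NormedAddCommGroup W] [NormedSpace ℝ W] {f : V → W} (hf : ContDiff ℝ (⊤ : ℕ∞) f)
    (x p q : V) : fderiv ℝ (fderiv ℝ f) x p q = fderiv ℝ (fderiv ℝ f) x q p :=
  (hf.contDiffAt.isSymmSndFDerivAt (by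
    simp only [minSmoothness_of_isRCLikeNormedField]
    exact WithTop.coe_le_coe.mpr (le_top : (2 : ℕ∞) ≤ ⊤))) p q

variable (hv : ContDiff ℝ (⊤ : ℕ∞) v)
  (hsym : ∀ x p q, ⟪fderiv ℝ v x p, q⟫ = ⟪fderiv ℝ v x q, p⟫)
include hv hsym

theorem inner_fderiv₂_comm (x p q r : E) :
    ⟪fderiv ℝ (fderiv ℝ v) x p q, r⟫ = ⟪fderiv ℝ (fderiv ℝ v) x p r, q⟫ := by
  have J := (Jet2.quadratic x p 0).comp (contDiff_top_fderiv hv)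
  have J1 := (J.clm_apply (Jet2.const q)).inner (Jet2.const r)
  have J2 := (J.clm_apply (Jet2.const r)).inner (Jet2.const q)
  simp only [hsym _ r q] at J2
  simpa using (J1.unique J2).2.1

theorem inner_fderiv₃_eq (x p q : E) :
    ⟪fderiv ℝ (fderiv ℝ (fderiv ℝ v)) x p p q, q⟫ =
      ⟪fderiv ℝ (fderiv ℝ (fderiv ℝ v)) x q q p, p⟫ := by
  set U := fderiv ℝ (fderiv ℝ (fderiv ℝ v)) x with hU
  have J := fun p => (Jet2.quadratic x p 0).comp (contDiff_top_fderiv (contDiff_top_fderiv hv))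
  have h1 : U p p q = U p q p := by
    have J1 := ((J p).clm_apply (Jet2.const p)).clm_apply (Jet2.const q)
    have J2 := ((J p).clm_apply (Jet2.const q)).clm_apply (Jet2.const p)
    simp only [fderiv_fderiv_comm hv _ q p] at J2
    simpa using (J1.unique J2).2.1
  have h2 : U p q = U q p := fderiv_fderiv_comm (contDiff_top_fderiv hv) x p q
  have h3 : ⟪U q p p, q⟫ = ⟪U q p q, p⟫ := by
    have J1 := (((J q).clm_apply (Jet2.const p)).clm_apply (Jet2.const p)).inner (Jet2.const q)
    have J2 := (((J q).clm_apply (Jet2.const p)).clm_apply (Jet2.const q)).inner (Jet2.const p)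
    simp only [inner_fderiv₂_comm hv hsym _ p q p] at J2
    simpa using (J1.unique J2).2.1
  have h4 : U q p q = U q q p := by
    have J1 := ((J q).clm_apply (Jet2.const p)).clm_apply (Jet2.const q)
    have J2 := ((J q).clm_apply (Jet2.const q)).clm_apply (Jet2.const p)
    simp only [fderiv_fderiv_comm hv _ q p] at J2
    simpa using (J1.unique J2).2.1
  rw [h1, h2, h3, h4]

end Derivatives

section Soliton

variable {E : Type*} [NormedAddCommGroup E] [InnerProductSpace ℝ E] {ι : Type*} [Fintype ι]

/-- The gradient `v` of an entire graph over `E` satisfying the translating soliton equation with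
horizontal velocity `V` and vertical velocity `τ`. -/
structure IsSolitonGradient (b : OrthonormalBasis ι ℝ E) (v : E → E) (V : E) (τ : ℝ) : Prop where
  contDiff : ContDiff ℝ (⊤ : ℕ∞) v
  symm : ∀ x p q, ⟪fderiv ℝ v x p, q⟫ = ⟪fderiv ℝ v x q, p⟫
  eqn : ∀ x, (1 + ⟪v x, v x⟫) * (∑ i, ⟪fderiv ℝ v x (b i), b i⟫ + ⟪V, v x⟫ - τ) =
    ⟪fderiv ℝ v x (v x), v x⟫

namespace IsSolitonGradient

variable {b : OrthonormalBasis ι ℝ E} {v : E → E} {V : E} {τ : ℝ}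
  (h : IsSolitonGradient b v V τ)
include h

theorem jet_eqn (x z : E) :
    (⟪fderiv ℝ v x z, v x⟫ + ⟪v x, fderiv ℝ v x z⟫) *
        (∑ i, ⟪fderiv ℝ v x (b i), b i⟫ + ⟪V, v x⟫ - τ) +
      (1 + ⟪v x, v x⟫) *
        (∑ i, ⟪fderiv ℝ (fderiv ℝ v) x z (b i), b i⟫ + ⟪V, fderiv ℝ v x z⟫) =
      ⟪fderiv ℝ (fderiv ℝ v) x z (v x), v x⟫ + 2 * ⟪fderiv ℝ v x (v x), fderiv ℝ v x z⟫ ∧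
    2 * (⟪fderiv ℝ v x z, fderiv ℝ v x z⟫ + ⟪v x, fderiv ℝ (fderiv ℝ v) x z z⟫) *
        (∑ i, ⟪fderiv ℝ v x (b i), b i⟫ + ⟪V, v x⟫ - τ) +
      4 * ⟪v x, fderiv ℝ v x z⟫ *
        (∑ i, ⟪fderiv ℝ (fderiv ℝ v) x z (b i), b i⟫ + ⟪V, fderiv ℝ v x z⟫) +
      (1 + ⟪v x, v x⟫) *
        (∑ i, ⟪fderiv ℝ (fderiv ℝ (fderiv ℝ v)) x z z (b i), b i⟫ +
          ⟪V, fderiv ℝ (fderiv ℝ v) x z z⟫) =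
      ⟪fderiv ℝ (fderiv ℝ (fderiv ℝ v)) x z z (v x), v x⟫ +
        4 * ⟪fderiv ℝ (fderiv ℝ v) x z (v x), fderiv ℝ v x z⟫ +
        2 * ⟪fderiv ℝ v x (fderiv ℝ v x z), fderiv ℝ v x z⟫ +
        2 * ⟪fderiv ℝ v x (v x), fderiv ℝ (fderiv ℝ v) x z z⟫ := by
  have Jx := Jet2.quadratic x z 0
  have Jv := Jx.comp h.contDiff
  have JS := Jx.comp (contDiff_top_fderiv h.contDiff)
  have J1 := ((Jet2.const (1 : ℝ)).add (Jv.inner Jv)).mul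
    (((Jet2.sum Finset.univ fun i _ =>
      (JS.clm_apply (Jet2.const (b i))).inner (Jet2.const (b i))).add
        ((Jet2.const V).inner Jv)).add (Jet2.const (-τ)))
  have J2 := (JS.clm_apply Jv).inner Jv
  simp only [← sub_eq_add_neg, h.eqn] at J1
  obtain ⟨-, h1, h2⟩ := J1.unique J2
  set S := fderiv ℝ v x
  set T := fderiv ℝ (fderiv ℝ v) x with hT
  set U := fderiv ℝ (fderiv ℝ (fderiv ℝ v)) x
  have s1 : ∀ p q, ⟪S p, q⟫ = ⟪S q, p⟫ := h.symm x
  have s2 : ∀ p q r, ⟪T p q, r⟫ = ⟪T p r, q⟫ := inner_fderiv₂_comm h.contDiff h.symm x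
  simp only [inner_add_left, inner_zero_left, inner_zero_right, map_zero, add_zero, zero_add,
    mul_zero, real_inner_comm (v x)] at h1 h2
  have e1 : ⟪v x, S (S z)⟫ = ⟪S (v x), S z⟫ := by rw [real_inner_comm, s1]
  have e2 : ⟪v x, T z (S z)⟫ = ⟪T z (v x), S z⟫ := by rw [real_inner_comm, s2]
  have e3 : ⟪v x, S (T z z)⟫ = ⟪S (v x), T z z⟫ := by rw [real_inner_comm, s1]
  simp only [real_inner_comm (v x), inner_add_right, e1, e2, e3] at h1 h2 ⊢
  constructor
  · linarith
  · linarith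

/-- Along the parallel transport `X` of `X₀` in the directions of an adapted frame, the Hessian
`⟪Dv X, X⟫` has zero total second variation, and so have the metric `⟪X, X⟫ + ⟪v, X⟫²` and `v`. -/
theorem exists_jets [Nonempty ι] (x X : E) (hX : ⟪X, X⟫ + ⟪v x, X⟫ * ⟪v x, X⟫ = 1) :
    let S := fderiv ℝ v x
    let ω := (1 + ‖v x‖ ^ 2)⁻¹
    ∃ (y Y : ι → ℝ → E) (c w2 : ι → E) (s1 s2 γ2 : ι → ℝ),
      (∀ i, Jet2 (y i) x (tiltedFrame b (v x) i) (c i)) ∧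
      (∑ i, c i = V - (2 * ω) • (S (v x) - (ω * ⟪v x, S (v x)⟫) • v x)) ∧
      (∀ i, Jet2 (fun t => v (y i t)) (v x) (S (tiltedFrame b (v x) i)) (w2 i)) ∧
      (∑ i, ⟪w2 i, v x⟫ = 0) ∧
      (∀ i, Jet2 (fun t => ⟪fderiv ℝ v (y i t) (Y i t), Y i t⟫) ⟪S X, X⟫ (s1 i) (s2 i)) ∧
      (∑ i, s2 i = 0) ∧
      (∀ i, Jet2 (fun t => ⟪Y i t, Y i t⟫ + ⟪v (y i t), Y i t⟫ * ⟪v (y i t), Y i t⟫)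
        1 0 (γ2 i)) ∧
      ∑ i, γ2 i = 0 := by
  intro S ω
  set T := fderiv ℝ (fderiv ℝ v) x with hT
  set U := fderiv ℝ (fderiv ℝ (fderiv ℝ v)) x with hU
  set n : ℝ := (Fintype.card ι : ℝ) with hn
  have hn0 : n ≠ 0 := by simp [hn]
  set m := tiltedFrame b (v x) with hm
  have s1 : ∀ p q, ⟪S p, q⟫ = ⟪S q, p⟫ := h.symm x
  have t1 : ∀ p q r, ⟪T p q, r⟫ = ⟪T p r, q⟫ := inner_fderiv₂_comm h.contDiff h.symm x
  have t2 : ∀ p q, T p q = T q p := fderiv_fderiv_comm h.contDiff x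
  have u1 : ∀ p q, ⟪U p p q, q⟫ = ⟪U q q p, p⟫ := inner_fderiv₃_eq h.contDiff h.symm x
  have hω : ω * (1 + ⟪v x, v x⟫) = 1 := by
    rw [real_inner_self_eq_norm_sq]; exact inv_mul_cancel₀ (by positivity)
  have mm : ∀ p q, ∑ i, ⟪m i, p⟫ * ⟪m i, q⟫ = ⟪p, q⟫ - ω * (⟪v x, p⟫ * ⟪v x, q⟫) :=
    sum_inner_tiltedFrame_mul b (v x)
  have mT : ∀ z, ∑ i, ⟪T (m i) (m i), z⟫ = ∑ i, ⟪T (b i) (b i), z⟫ - ω * ⟪T (v x) (v x), z⟫ :=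
    fun z => sum_inner_apply_tiltedFrame b (v x) z T
  have mU : ∑ i, ⟪U (m i) (m i) X, X⟫ = ∑ i, ⟪U (b i) (b i) X, X⟫ - ω * ⟪U (v x) (v x) X, X⟫ := by
    have := sum_tiltedFrame b (v x) (LinearMap.mk₂ ℝ (fun p q : E => ⟪U p q X, X⟫)
      (fun _ _ _ => by simp [inner_add_left]) (fun _ _ _ => by simp [inner_smul_left])
      (fun _ _ _ => by simp [inner_add_left]) (fun _ _ _ => by simp [inner_smul_left]))
    simpa using this
  obtain ⟨-, p2⟩ := h.jet_eqn x X
  have p1 := fun z => (h.jet_eqn x z).1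
  have p0 := h.eqn x
  have hS : fderiv ℝ v x = S := rfl
  simp only [hS, ← hT, ← hU] at p0 p1 p2
  set a : E → E := fun z => z - (ω * ⟪v x, z⟫) • v x with ha
  set A := a (S X) with hA
  set k := ω * ⟪S (v x), A⟫ with hk
  set c := V - (2 * ω) • (S (v x) - (ω * ⟪v x, S (v x)⟫) • v x) with hc
  set Z := (2 * k * ω) • v x - ω • a (S A) with hZ
  set Y : ι → E := fun i => (-(⟪m i, S X⟫ * ω)) • v x with hY
  have sumc : ∀ f : ℝ, ∑ _i : ι, n⁻¹ * f = f := by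
    intro f
    rw [Finset.sum_const, Finset.card_univ, nsmul_eq_mul, ← hn]; field_simp
  have Jx := fun i => Jet2.quadratic x (m i) (n⁻¹ • c)
  have JX := fun i => Jet2.quadratic X (Y i) (n⁻¹ • Z)
  have Jv := fun i => (Jx i).comp h.contDiff
  have JS := fun i => (Jx i).comp (contDiff_top_fderiv h.contDiff)
  have Js := fun i => ((JS i).clm_apply (JX i)).inner (JX i)
  have Jg := fun i => ((JX i).inner (JX i)).add (((Jv i).inner (JX i)).mul ((Jv i).inner (JX i)))
  -- second variation of `v`
  have hv2 : ∀ z, ∑ i, ⟪T (m i) (m i) + S (n⁻¹ • c), z⟫ = 0 := by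
    intro z
    have e0 : ∀ i, ⟪T (b i) (b i), z⟫ = ⟪T z (b i), b i⟫ := fun i => by
      rw [t1, t2]
    have e1 : ⟪T (v x) (v x), z⟫ = ⟪T z (v x), v x⟫ := by rw [t1, t2]
    simp only [inner_add_left, map_smul, inner_smul_left, conj_trivial, Finset.sum_add_distrib,
      mT, sumc, e0, e1]
    have e2 : ⟪S c, z⟫ = ⟪V, S z⟫ - 2 * ω * (⟪S (v x), S z⟫ - ω * ⟪v x, S (v x)⟫ * ⟪v x, S z⟫) := by
      rw [s1, real_inner_comm, hc]
      simp only [inner_sub_left, inner_smul_left, conj_trivial]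
    rw [e2]
    have := p1 z
    simp only [real_inner_comm (v x)] at this p0 ⊢
    linear_combination ω * this
      - (∑ i, ⟪T z (b i), b i⟫ + ⟪V, S z⟫) * hω
      - 2 * ω ^ 2 * ⟪v x, S z⟫ * p0
      + 2 * ω * ⟪v x, S z⟫ * (∑ i, ⟪S (b i), b i⟫ + ⟪v x, V⟫ - τ) * hω
  have cv : ∀ p, ⟪S p, v x⟫ = ⟪v x, S p⟫ := fun p => real_inner_comm _ _
  have vA : ⟪v x, A⟫ = ω * ⟪v x, S X⟫ := by
    rw [hA, ha]; simp only [inner_sub_right, inner_smul_right]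
    linear_combination -⟪v x, S X⟫ * hω
  have SZ : ⟪S X, Z⟫ = 2 * k * ω * ⟪v x, S X⟫ - ω * ⟪S A, A⟫ := by
    have e1 : ⟪S X, S A⟫ - ω * (⟪v x, S A⟫ * ⟪v x, S X⟫) = ⟪S A, A⟫ := by
      change _ = ⟪S A, a (S X)⟫
      simp only [ha, inner_sub_right, inner_smul_right, cv]
      rw [real_inner_comm (S X) (S A)]
      ring
    rw [← e1, hZ, ha]
    simp only [inner_sub_right, inner_smul_right, cv]
    ring
  have SAA : ⟪S A, A⟫ = ⟪S X, S (S X)⟫ - 2 * ω * ⟪v x, S X⟫ * ⟪S (v x), S X⟫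
      + ω ^ 2 * ⟪v x, S X⟫ ^ 2 * ⟪v x, S (v x)⟫ := by
    have e1 : ⟪v x, S (S X)⟫ = ⟪S (v x), S X⟫ := by rw [← cv, s1]
    have e2 : ⟪S (S X), S X⟫ = ⟪S X, S (S X)⟫ := real_inner_comm _ _
    rw [hA, ha]
    simp only [inner_sub_right, inner_smul_right, inner_sub_left, inner_smul_left, conj_trivial,
      map_sub, map_smul, cv, e1, e2]
    ring
  have hk' : k = ω * (⟪S (v x), S X⟫ - ω * ⟪v x, S X⟫ * ⟪v x, S (v x)⟫) := by
    rw [hk, hA, ha]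
    simp only [inner_sub_right, inner_smul_right, cv]
  have hTc : ⟪T c X, X⟫ = ⟪V, T X X⟫
      - 2 * ω * (⟪S (v x), T X X⟫ - ω * ⟪v x, S (v x)⟫ * ⟪v x, T X X⟫) := by
    rw [t2, t1, real_inner_comm, hc]
    simp only [inner_sub_left, inner_smul_left, conj_trivial]
  have hs2 : ∑ i, (⟪(U (m i) (m i) + T (n⁻¹ • c)) X + T (m i) (Y i) + T (m i) (Y i)
      + S (n⁻¹ • Z), X⟫ + 2 * ⟪T (m i) X + S (Y i), Y i⟫ + ⟪S X, n⁻¹ • Z⟫) = 0 := by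
    have e1 : ∀ i, ⟪T (m i) X, v x⟫ = ⟪m i, T X (v x)⟫ := by
      intro i
      rw [t2, t1, real_inner_comm]
    have e2 : ∀ i, ⟪(U (m i) (m i) + T (n⁻¹ • c)) X + T (m i) (Y i) + T (m i) (Y i)
        + S (n⁻¹ • Z), X⟫ + 2 * ⟪T (m i) X + S (Y i), Y i⟫ + ⟪S X, n⁻¹ • Z⟫ =
        ⟪U (m i) (m i) X, X⟫ + n⁻¹ * (⟪T c X, X⟫ + 2 * ⟪S X, Z⟫)
          - 4 * ω * (⟪m i, S X⟫ * ⟪m i, T X (v x)⟫)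
          + 2 * ω ^ 2 * ⟪v x, S (v x)⟫ * (⟪m i, S X⟫ * ⟪m i, S X⟫) := by
      intro i
      have e3 : ⟪T (m i) (v x), X⟫ = ⟪m i, T X (v x)⟫ := by rw [t1, e1]
      have e4 : ⟪S Z, X⟫ = ⟪S X, Z⟫ := s1 _ _
      simp only [inner_add_left, map_smul, inner_smul_left, conj_trivial, inner_smul_right,
        add_apply, smul_apply, e3, e4, hY, e1, cv]
      ring
    rw [Finset.sum_congr rfl fun i _ => e2 i]
    simp only [Finset.sum_add_distrib, Finset.sum_sub_distrib, ← Finset.mul_sum, mm, mU, sumc]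
    have u2 : ∑ i, ⟪U (b i) (b i) X, X⟫ = ∑ i, ⟪U X X (b i), b i⟫ :=
      Finset.sum_congr rfl fun i _ => u1 _ _
    have e5 : ⟪S X, T X (v x)⟫ = ⟪T X (v x), S X⟫ := real_inner_comm _ _
    have e6 : ⟪v x, T X (v x)⟫ = ⟪T X (v x), v x⟫ := real_inner_comm _ _
    have e7 : ⟪S (S X), S X⟫ = ⟪S X, S (S X)⟫ := real_inner_comm _ _
    have q1 := p1 X
    rw [e7] at p2
    simp only [cv] at p0 q1
    rw [u2, u1, hTc, SZ, SAA, hk', e5, e6]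
    linear_combination ω * p2
      - (∑ i, ⟪U X X (b i), b i⟫ + ⟪V, T X X⟫) * hω
      - 2 * ω ^ 2 * (⟪S X, S X⟫ + ⟪v x, T X X⟫) * p0
      + 2 * ω * (∑ i, ⟪S (b i), b i⟫ + ⟪V, v x⟫ - τ) * (⟪S X, S X⟫ + ⟪v x, T X X⟫) * hω
      - 4 * ω ^ 2 * ⟪v x, S X⟫ * q1
      + 4 * ω * ⟪v x, S X⟫ * (∑ i, ⟪T X (b i), b i⟫ + ⟪V, S X⟫) * hω
      + 8 * ω ^ 3 * ⟪v x, S X⟫ ^ 2 * p0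
      - 8 * ω ^ 2 * ⟪v x, S X⟫ ^ 2 * (∑ i, ⟪S (b i), b i⟫ + ⟪V, v x⟫ - τ) * hω
  have hg1 : ∀ i, ⟪Y i, X⟫ + ⟪X, Y i⟫ + ((⟪S (m i), X⟫ + ⟪v x, Y i⟫) * ⟪v x, X⟫
      + ⟪v x, X⟫ * (⟪S (m i), X⟫ + ⟪v x, Y i⟫)) = 0 := by
    intro i
    have e1 : ⟪S (m i), X⟫ = ⟪m i, S X⟫ := by rw [s1, real_inner_comm]
    rw [real_inner_comm (Y i) X, e1, hY]
    simp only [inner_smul_right, inner_smul_left, conj_trivial]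
    linear_combination - 2 * ⟪m i, S X⟫ * ⟪v x, X⟫ * hω
  have hg2 : ∑ i, (⟪n⁻¹ • Z, X⟫ + 2 * ⟪Y i, Y i⟫ + ⟪X, n⁻¹ • Z⟫ +
      ((⟪T (m i) (m i) + S (n⁻¹ • c), X⟫ + 2 * ⟪S (m i), Y i⟫ + ⟪v x, n⁻¹ • Z⟫) * ⟪v x, X⟫ +
        2 * ((⟪S (m i), X⟫ + ⟪v x, Y i⟫) * (⟪S (m i), X⟫ + ⟪v x, Y i⟫)) +
        ⟪v x, X⟫ * (⟪T (m i) (m i) + S (n⁻¹ • c), X⟫ + 2 * ⟪S (m i), Y i⟫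
          + ⟪v x, n⁻¹ • Z⟫))) = 0 := by
    have e1 : ∀ i p, ⟪S (m i), p⟫ = ⟪m i, S p⟫ := fun i p => by rw [s1, real_inner_comm]
    have e2 : ∀ i, ⟪S (m i), X⟫ + ⟪v x, Y i⟫ = ω * ⟪m i, S X⟫ := by
      intro i
      rw [e1, hY]
      simp only [inner_smul_right]
      linear_combination - ⟪m i, S X⟫ * hω
    have e3 : ∀ i, ⟪S (m i), Y i⟫ = -ω * (⟪m i, S X⟫ * ⟪m i, S (v x)⟫) := by
      intro i
      rw [hY]
      simp only [map_smul, inner_smul_right, e1]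
      ring
    have e4 : ∀ i, ⟪Y i, Y i⟫ = ω ^ 2 * ⟪v x, v x⟫ * (⟪m i, S X⟫ * ⟪m i, S X⟫) := by
      intro i
      rw [hY]
      simp only [inner_smul_right, inner_smul_left, conj_trivial]
      ring
    have e5 : ω * ⟪v x, S A⟫ = k := by rw [← cv, s1, hk]
    have e6 : ⟪v x, Z⟫ = 2 * k * ω * ⟪v x, v x⟫ - ω * k := by
      rw [hZ, ha]
      simp only [inner_sub_right, inner_smul_right]
      linear_combination ω * ⟪v x, S A⟫ * hω - ω * e5
    have e7 : ⟪X, S A⟫ = ⟪S X, S X⟫ - ω * ⟪v x, S X⟫ ^ 2 := by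
      rw [real_inner_comm, s1, hA, ha]
      simp only [inner_sub_right, inner_smul_right, cv]
      ring
    have e8 : ⟪X, Z⟫ = 3 * k * ω * ⟪v x, X⟫ - ω * (⟪S X, S X⟫ - ω * ⟪v x, S X⟫ ^ 2) := by
      rw [hZ, ha, ← e7]
      simp only [inner_sub_right, inner_smul_right, real_inner_comm (v x) X]
      linear_combination ω * ⟪v x, X⟫ * e5
    have e9 : ∀ i, (⟪n⁻¹ • Z, X⟫ + 2 * ⟪Y i, Y i⟫ + ⟪X, n⁻¹ • Z⟫ +
        ((⟪T (m i) (m i) + S (n⁻¹ • c), X⟫ + 2 * ⟪S (m i), Y i⟫ + ⟪v x, n⁻¹ • Z⟫) * ⟪v x, X⟫ +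
          2 * ((⟪S (m i), X⟫ + ⟪v x, Y i⟫) * (⟪S (m i), X⟫ + ⟪v x, Y i⟫)) +
          ⟪v x, X⟫ * (⟪T (m i) (m i) + S (n⁻¹ • c), X⟫ + 2 * ⟪S (m i), Y i⟫
            + ⟪v x, n⁻¹ • Z⟫))) =
        n⁻¹ * (2 * ⟪X, Z⟫ + 2 * ⟪v x, X⟫ * ⟪v x, Z⟫)
          + (2 * ω ^ 2 * ⟪v x, v x⟫ + 2 * ω ^ 2) * (⟪m i, S X⟫ * ⟪m i, S X⟫)
          - 4 * ω * ⟪v x, X⟫ * (⟪m i, S X⟫ * ⟪m i, S (v x)⟫)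
          + 2 * ⟪v x, X⟫ * ⟪T (m i) (m i) + S (n⁻¹ • c), X⟫ := by
      intro i
      rw [e2, e3, e4]
      simp only [inner_smul_right, inner_smul_left, conj_trivial, real_inner_comm X Z]
      ring
    rw [Finset.sum_congr rfl fun i _ => e9 i]
    simp only [Finset.sum_add_distrib, Finset.sum_sub_distrib, ← Finset.mul_sum, mm, hv2, sumc]
    rw [e6, e8, real_inner_comm (S (v x)) (S X)]
    linear_combination (4 * k * ⟪v x, X⟫ + 2 * ω * (⟪S X, S X⟫ - ω * ⟪v x, S X⟫ ^ 2)) * hω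
      + 4 * ⟪v x, X⟫ * hk'
  refine ⟨_, _, _, _, _, _, _, Jx, ?_, Jv, hv2 (v x), Js, hs2, fun i => ?_, hg2⟩
  · rw [Finset.sum_const, Finset.card_univ, ← Nat.cast_smul_eq_nsmul ℝ, ← hn, smul_smul,
      mul_inv_cancel₀ hn0, one_smul]
  · have := Jg i
    rwa [hX, hg1 i] at this

end IsSolitonGradient

theorem mul_inner_le_of_quadratic_le {S : E →L[ℝ] E} (hS : ∀ p q, ⟪S p, q⟫ = ⟪S q, p⟫)
    {ρ M : ℝ} (hρ : 0 ≤ ρ) (hM : ∀ Y, ρ * |⟪S Y, Y⟫| ≤ M * ⟪Y, Y⟫) (α β : E) :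
    ρ * ⟪S α, β⟫ ≤ M / 2 * (⟪α, α⟫ + ⟪β, β⟫) := by
  have a1 := (mul_le_mul_of_nonneg_left (le_abs_self ⟪S (α + β), α + β⟫) hρ).trans (hM _)
  have a2 := (mul_le_mul_of_nonneg_left (neg_le_abs ⟪S (α - β), α - β⟫) hρ).trans (hM _)
  simp only [map_add, map_sub, inner_add_left, inner_add_right, inner_sub_left,
    inner_sub_right, hS β α, real_inner_comm α β] at a1 a2
  linarith

theorem mul_inner_drift_le {S : E →L[ℝ] E} (hS : ∀ p q, ⟪S p, q⟫ = ⟪S q, p⟫) {R M ω : ℝ}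
    {x w : E} (hR : 0 < R) (hx : ⟪x, x⟫ ≤ R ^ 2) (hω0 : 0 ≤ ω) (hω1 : ω ≤ 1)
    (hωw : ω * ⟪w, w⟫ ≤ 1) (V : E) (hM0 : 0 ≤ M)
    (hM : ∀ Y, (R ^ 2 - ⟪x, x⟫) * |⟪S Y, Y⟫| ≤ M * ⟪Y, Y⟫) :
    (R ^ 2 - ⟪x, x⟫) * ⟪x, V - (2 * ω) • (S w - (ω * ⟪w, S w⟫) • w)⟫ ≤
      R ^ 3 * ‖V‖ + 2 * (M * R) := by
  have hx0 : 0 ≤ ⟪x, x⟫ := real_inner_self_nonneg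
  have hρ0 : 0 ≤ R ^ 2 - ⟪x, x⟫ := by linarith
  have e1 : ⟪x, V⟫ ≤ R * ‖V‖ := by
    have := real_inner_le_norm x V
    have hxR' : ‖x‖ ≤ R := by
      rw [real_inner_self_eq_norm_sq] at hx
      exact (sq_le_sq₀ (norm_nonneg x) hR.le).mp hx
    have := mul_le_mul_of_nonneg_right hxR' (norm_nonneg V)
    linarith
  have e2 := mul_inner_le_of_quadratic_le hS hρ0 hM ((-R) • ω • w) (x - (ω * ⟪w, x⟫) • w)
  have e3 : ⟪(-R) • ω • w, (-R) • ω • w⟫ ≤ R ^ 2 := by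
    simp only [inner_smul_left, inner_smul_right, conj_trivial]
    have : ω * (ω * ⟪w, w⟫) ≤ 1 :=
      mul_le_one₀ hω1 (mul_nonneg hω0 real_inner_self_nonneg) hωw
    linarith [mul_le_mul_of_nonneg_left this (sq_nonneg R)]
  have e4 : ⟪x - (ω * ⟪w, x⟫) • w, x - (ω * ⟪w, x⟫) • w⟫ ≤ R ^ 2 := by
    simp only [inner_smul_left, inner_smul_right, conj_trivial, inner_sub_left,
      inner_sub_right, real_inner_comm w x]
    have h0 : 0 ≤ ω * ⟪w, x⟫ ^ 2 := by positivity
    linarith [mul_le_mul_of_nonneg_left hωw h0]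
  have e5 : ⟪S ((-R) • ω • w), x - (ω * ⟪w, x⟫) • w⟫ =
      -(R * ⟪x, ω • (S w - (ω * ⟪w, S w⟫) • w)⟫) := by
    simp only [map_smul, inner_smul_left, inner_smul_right, conj_trivial, inner_sub_right,
      real_inner_comm x (S w), real_inner_comm w (S w), real_inner_comm w x]
    ring
  have e6 : R * (-((R ^ 2 - ⟪x, x⟫) * ⟪x, ω • (S w - (ω * ⟪w, S w⟫) • w)⟫)) ≤ R * (M * R) := by
    rw [e5] at e2
    linarith [mul_le_mul_of_nonneg_left (add_le_add e3 e4) (div_nonneg hM0 zero_le_two)]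
  have e7 := le_of_mul_le_mul_left e6 hR
  have e8 : (R ^ 2 - ⟪x, x⟫) * (R * ‖V‖) ≤ R ^ 2 * (R * ‖V‖) :=
    mul_le_mul_of_nonneg_right (by linarith) (by positivity)
  have e9 := mul_le_mul_of_nonneg_left e1 hρ0
  rw [mul_smul, inner_sub_right, inner_smul_right]
  linarith

namespace IsSolitonGradient

variable {b : OrthonormalBasis ι ℝ E} {v : E → E} {V : E} {τ : ℝ}
  (h : IsSolitonGradient b v V τ)
include h

/-- The second derivative test for `ρ² ⟪Dv X, X⟫² / γ² + C |v|²` at an interior maximum, where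
`ρ = R² - |x|²` and `γ = ⟪X, X⟫ + ⟪v, X⟫²`. -/
theorem second_variation_nonpos [Nonempty ι] {R C P : ℝ} {x X : E}
    (hX : ⟪X, X⟫ + ⟪v x, X⟫ * ⟪v x, X⟫ = 1)
    (hmax : ∀ᶠ y in nhds x, ∀ Y, (R ^ 2 - ⟪y, y⟫) ^ 2 * ⟪fderiv ℝ v y Y, Y⟫ ^ 2 +
      (C * ⟪v y, v y⟫ - P) * (⟪Y, Y⟫ + ⟪v y, Y⟫ * ⟪v y, Y⟫) ^ 2 ≤ 0)
    (heq : (R ^ 2 - ⟪x, x⟫) ^ 2 * ⟪fderiv ℝ v x X, X⟫ ^ 2 + (C * ⟪v x, v x⟫ - P) = 0) :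
    ⟪fderiv ℝ v x X, X⟫ ^ 2 * (2 * (R ^ 2 - ⟪x, x⟫) *
      (-2 * ∑ i, ⟪tiltedFrame b (v x) i, tiltedFrame b (v x) i⟫ -
        2 * ⟪x, V - (2 * (1 + ‖v x‖ ^ 2)⁻¹) • (fderiv ℝ v x (v x) -
          ((1 + ‖v x‖ ^ 2)⁻¹ * ⟪v x, fderiv ℝ v x (v x)⟫) • v x)⟫) -
      24 * ∑ i, ⟪tiltedFrame b (v x) i, x⟫ * ⟪tiltedFrame b (v x) i, x⟫) +
      2 * C * ∑ i, ⟪fderiv ℝ v x (tiltedFrame b (v x) i),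
        fderiv ℝ v x (tiltedFrame b (v x) i)⟫ ≤ 0 := by
  obtain ⟨y, Y, c, w2, s1, s2, γ2, hy, hc, hw, hw0, hs, hs0, hγ, hγ0⟩ := h.exists_jets x X hX
  rw [← hc]
  clear hc
  set m := tiltedFrame b (v x)
  set S := fderiv ℝ v x
  set q := ⟪S X, X⟫
  set ρ := R ^ 2 - ⟪x, x⟫
  have key : ∀ i, q ^ 2 * (2 * ρ * (-2 * ⟪m i, m i⟫ - 2 * ⟪x, c i⟫) - 24 * (⟪m i, x⟫ * ⟪m i, x⟫))
      + 2 * C * ⟪S (m i), S (m i)⟫ + 2 * ρ ^ 2 * q * s2 i + 2 * C * ⟪w2 i, v x⟫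
      + 2 * (C * ⟪v x, v x⟫ - P) * γ2 i ≤ 0 := by
    intro i
    have Jρ := ((Jet2.const (R ^ 2)).add ((Jet2.const (-1)).mul ((hy i).inner (hy i))))
    have Jψ := ((Jρ.mul Jρ).mul ((hs i).mul (hs i))).add
      ((((Jet2.const C).mul ((hw i).inner (hw i))).add (Jet2.const (-P))).mul ((hγ i).mul (hγ i)))
    have hloc : IsLocalMax (fun t => ((R ^ 2 + -1 * ⟪y i t, y i t⟫) *
        (R ^ 2 + -1 * ⟪y i t, y i t⟫) * (⟪fderiv ℝ v (y i t) (Y i t), Y i t⟫ *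
        ⟪fderiv ℝ v (y i t) (Y i t), Y i t⟫) + (C * ⟪v (y i t), v (y i t)⟫ + -P) *
        ((⟪Y i t, Y i t⟫ + ⟪v (y i t), Y i t⟫ * ⟪v (y i t), Y i t⟫) *
        (⟪Y i t, Y i t⟫ + ⟪v (y i t), Y i t⟫ * ⟪v (y i t), Y i t⟫)))) 0 := by
      have hcont : Filter.Tendsto (y i) (nhds 0) (nhds x) := by
        obtain ⟨h0, f', hf', -⟩ := hy i
        have := (hf' 0).continuousAt.tendsto
        rwa [h0] at this
      filter_upwards [hcont.eventually hmax] with t ht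
      have h0 := Jψ.1
      simp only at h0
      rw [h0]
      have := ht (Y i t)
      linarith
    have := Jψ.nonpos_of_isLocalMax hloc
    refine le_trans (le_of_sub_nonneg ?_) this
    rw [real_inner_comm (v x) (w2 i), real_inner_comm x (m i), real_inner_comm x (c i),
      real_inner_comm (S (m i)) (v x),
      show R ^ 2 + -1 * ⟪x, x⟫ = ρ by simp only [ρ]; ring]
    refine (mul_nonneg zero_le_two (sq_nonneg (ρ * s1 i + 2 * (-2 * ⟪x, m i⟫) * q))).trans_eq ?_
    ring
  have := Finset.sum_nonpos fun i (_ : i ∈ Finset.univ) => key i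
  simp only [Finset.sum_add_distrib, ← Finset.mul_sum, Finset.sum_sub_distrib, hw0, hs0, hγ0]
    at this
  rw [inner_sum]
  linarith

/-- At an interior maximum with `⟪Dv X, X⟫ ≠ 0` the weight `C` is bounded by the growth of the
cut-off and by the size of the drift. -/
theorem weight_le [Nonempty ι] {R C P K G : ℝ} {x X : E} (hR : 1 ≤ R)
    (hX : ⟪X, X⟫ + ⟪v x, X⟫ * ⟪v x, X⟫ = 1) (hxR : ⟪x, x⟫ < R ^ 2) (hC : 0 ≤ C)
    (hvK : ⟪v x, v x⟫ ≤ K) (hq : ⟪fderiv ℝ v x X, X⟫ ≠ 0)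
    (hG : ∀ Y, (R ^ 2 - ⟪x, x⟫) * |⟪fderiv ℝ v x Y, Y⟫| ≤ G * (⟪Y, Y⟫ + ⟪v x, Y⟫ * ⟪v x, Y⟫))
    (hmax : ∀ᶠ y in nhds x, ∀ Y, (R ^ 2 - ⟪y, y⟫) ^ 2 * ⟪fderiv ℝ v y Y, Y⟫ ^ 2 +
      (C * ⟪v y, v y⟫ - P) * (⟪Y, Y⟫ + ⟪v y, Y⟫ * ⟪v y, Y⟫) ^ 2 ≤ 0)
    (heq : (R ^ 2 - ⟪x, x⟫) ^ 2 * ⟪fderiv ℝ v x X, X⟫ ^ 2 + (C * ⟪v x, v x⟫ - P) = 0) :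
    2 * C ≤ (1 + K) * ((4 * Fintype.card ι + 4 * ‖V‖ + 24 + 8 * (1 + K)) * (R ^ 3 + R * G)) := by
  have main := h.second_variation_nonpos hX hmax heq
  have hv0 : 0 ≤ ⟪v x, v x⟫ := real_inner_self_nonneg
  have hN : ‖v x‖ ^ 2 = ⟪v x, v x⟫ := (real_inner_self_eq_norm_sq _).symm
  have hω : (1 + ‖v x‖ ^ 2)⁻¹ * (1 + ⟪v x, v x⟫) = 1 := by
    rw [hN]; exact inv_mul_cancel₀ (by positivity)
  have hω0 : 0 < (1 + ‖v x‖ ^ 2)⁻¹ := by positivity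
  set ω := (1 + ‖v x‖ ^ 2)⁻¹
  set S := fderiv ℝ v x
  set q := ⟪S X, X⟫
  set ρ := R ^ 2 - ⟪x, x⟫ with hρ
  set N := ⟪v x, v x⟫ with hNdef
  have hρ0 : 0 < ρ := sub_pos.mpr hxR
  have hx0 : 0 ≤ ⟪x, x⟫ := real_inner_self_nonneg
  have hρR : ρ ≤ R ^ 2 := by linarith
  have hω1 : ω ≤ 1 := by nlinarith
  have hωK : 1 ≤ ω * (1 + K) := by nlinarith
  have hωN : ω * N ≤ 1 := by nlinarith
  have s1 : ∀ p q, ⟪S p, q⟫ = ⟪S q, p⟫ := h.symm x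
  have cs : ∀ p : E, ⟪v x, p⟫ ^ 2 ≤ N * ⟪p, p⟫ := fun p => by
    rw [sq]; exact real_inner_mul_inner_self_le _ _
  have hG0 : 0 ≤ G := by
    have := hG X
    rw [hX, mul_one] at this
    exact (by positivity : 0 ≤ ρ * |⟪S X, X⟫|).trans this
  have b1 : ∑ i, ⟪tiltedFrame b (v x) i, tiltedFrame b (v x) i⟫ ≤ Fintype.card ι := by
    have := sum_tiltedFrame b (v x) (innerₗ E)
    simp only [innerₗ_apply_apply] at this
    rw [this]
    simp only [real_inner_self_eq_norm_sq, b.norm_eq_one, Finset.sum_const, Finset.card_univ,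
      one_pow, nsmul_eq_mul, mul_one]
    have : 0 ≤ (1 + ‖v x‖ ^ 2)⁻¹ * ‖v x‖ ^ 2 := by positivity
    linarith
  have b2 : ∑ i, ⟪tiltedFrame b (v x) i, x⟫ * ⟪tiltedFrame b (v x) i, x⟫ ≤ R ^ 2 := by
    rw [sum_inner_tiltedFrame_mul]
    have : 0 ≤ ω * (⟪v x, x⟫ * ⟪v x, x⟫) := mul_nonneg hω0.le (mul_self_nonneg _)
    linarith
  have b3 : ω * q ^ 2 ≤ ∑ i, ⟪S (tiltedFrame b (v x) i), S (tiltedFrame b (v x) i)⟫ := by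
    have hX1 : ⟪X, X⟫ ≤ 1 := by nlinarith [mul_self_nonneg ⟪v x, X⟫]
    have e1 := cs (S X)
    have e2 : q ^ 2 ≤ ⟪S X, S X⟫ * ⟪X, X⟫ := by
      rw [sq]; exact real_inner_mul_inner_self_le _ _
    have hS0 : 0 ≤ ⟪S X, S X⟫ := real_inner_self_nonneg
    have e3 : q ^ 2 ≤ ⟪S X, S X⟫ := e2.trans (mul_le_of_le_one_right hS0 hX1)
    have e4 : ∑ i, ⟪tiltedFrame b (v x) i, S X⟫ * ⟪tiltedFrame b (v x) i, S X⟫ ≤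
        ∑ i, ⟪S (tiltedFrame b (v x) i), S (tiltedFrame b (v x) i)⟫ := by
      refine Finset.sum_le_sum fun i _ => ?_
      rw [real_inner_comm (S X), s1 X]
      have := real_inner_mul_inner_self_le (S (tiltedFrame b (v x) i)) X
      have h0 : 0 ≤ ⟪S (tiltedFrame b (v x) i), S (tiltedFrame b (v x) i)⟫ :=
        real_inner_self_nonneg
      nlinarith
    rw [sum_inner_tiltedFrame_mul] at e4
    have e5 : ω * ⟪S X, S X⟫ ≤ ⟪S X, S X⟫ - ω * (⟪v x, S X⟫ * ⟪v x, S X⟫) := by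
      linear_combination (mul_le_mul_of_nonneg_left e1 hω0.le) + ⟪S X, S X⟫ * hω
    linarith [mul_le_mul_of_nonneg_left e3 hω0.le]
  have b4 : ρ * ⟪x, V - (2 * ω) • (S (v x) - (ω * ⟪v x, S (v x)⟫) • v x)⟫ ≤
      R ^ 3 * ‖V‖ + 2 * (1 + K) * (R * G) := by
    have g : ∀ Y, ρ * |⟪S Y, Y⟫| ≤ G * (1 + K) * ⟪Y, Y⟫ := by
      intro Y
      refine (hG Y).trans ?_
      rw [mul_assoc]
      refine mul_le_mul_of_nonneg_left ?_ hG0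
      have hY0 : 0 ≤ ⟪Y, Y⟫ := real_inner_self_nonneg
      linarith [cs Y, mul_le_mul_of_nonneg_right hvK hY0]
    have := mul_inner_drift_le (w := v x) s1 (by linarith) hxR.le hω0.le hω1 hωN V
      (mul_nonneg hG0 (by linarith)) g
    linarith
  have hq2 : 0 < q ^ 2 := by positivity
  have e1 : 2 * C * (ω * q ^ 2) ≤ 2 * C * ∑ i, ⟪S (tiltedFrame b (v x) i),
      S (tiltedFrame b (v x) i)⟫ := mul_le_mul_of_nonneg_left b3 (by linarith)
  have e2 := mul_le_mul_of_nonneg_left b1 hρ0.le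
  have e3 : ρ * Fintype.card ι ≤ R ^ 2 * Fintype.card ι :=
    mul_le_mul_of_nonneg_right hρR (Nat.cast_nonneg _)
  have e4 : 2 * C * ω ≤ 4 * R ^ 2 * Fintype.card ι + 4 * (R ^ 3 * ‖V‖ + 2 * (1 + K) * (R * G)) +
      24 * R ^ 2 := by
    refine le_of_mul_le_mul_left ?_ hq2
    have e5 : -(4 * R ^ 2 * Fintype.card ι) - 4 * (R ^ 3 * ‖V‖ + 2 * (1 + K) * (R * G)) -
        24 * R ^ 2 ≤ 2 * ρ * (-2 * ∑ i, ⟪tiltedFrame b (v x) i, tiltedFrame b (v x) i⟫ -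
          2 * ⟪x, V - (2 * ω) • (S (v x) - (ω * ⟪v x, S (v x)⟫) • v x)⟫) -
        24 * ∑ i, ⟪tiltedFrame b (v x) i, x⟫ * ⟪tiltedFrame b (v x) i, x⟫ := by
      linarith
    linarith [mul_le_mul_of_nonneg_left e5 hq2.le]
  have e5 : R ^ 2 ≤ R ^ 3 + R * G := by
    have : R ^ 2 ≤ R ^ 3 := pow_le_pow_right₀ hR (by norm_num)
    have : 0 ≤ R * G := mul_nonneg (by linarith) hG0
    linarith
  have e6 : R ^ 3 ≤ R ^ 3 + R * G := le_add_of_nonneg_right (mul_nonneg (by linarith) hG0)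
  have e7 : R * G ≤ R ^ 3 + R * G := le_add_of_nonneg_left (by positivity)
  have hK : 0 ≤ 1 + K := by linarith
  calc 2 * C ≤ 2 * C * (ω * (1 + K)) := le_mul_of_one_le_right (by linarith) hωK
    _ = (1 + K) * (2 * C * ω) := by ring
    _ ≤ _ := by
      refine mul_le_mul_of_nonneg_left (e4.trans ?_) hK
      have c1 := mul_le_mul_of_nonneg_left e5 (Nat.cast_nonneg (α := ℝ) (Fintype.card ι))
      have c2 := mul_le_mul_of_nonneg_left e6 (norm_nonneg V)
      have c3 := mul_le_mul_of_nonneg_left e7 hK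
      linarith

theorem exists_hessian_bound [FiniteDimensional ℝ E] [Nonempty ι] {K : ℝ}
    (hK : ∀ x, ⟪v x, v x⟫ ≤ K) {R : ℝ} (hR : 1 ≤ R) :
    ∃ G : ℝ, (∀ x Y, ⟪x, x⟫ ≤ R ^ 2 →
      (R ^ 2 - ⟪x, x⟫) * |⟪fderiv ℝ v x Y, Y⟫| ≤ G * (⟪Y, Y⟫ + ⟪v x, Y⟫ * ⟪v x, Y⟫)) ∧
      G ^ 2 ≤ K * ((1 + K) * ((4 * Fintype.card ι + 4 * ‖V‖ + 24 + 8 * (1 + K)) *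
        (R ^ 3 + R * G))) := by
  let i₀ := Classical.arbitrary ι
  have hK0 : 0 ≤ K := real_inner_self_nonneg.trans (hK 0)
  have cv : Continuous v := h.contDiff.continuous
  have cS : Continuous (fderiv ℝ v) := (contDiff_top_fderiv h.contDiff).continuous
  set γ : E → E → ℝ := fun x Y => ⟪Y, Y⟫ + ⟪v x, Y⟫ * ⟪v x, Y⟫ with hγ
  have γpos : ∀ x Y, Y ≠ 0 → 0 < γ x Y := fun x Y hY =>
    add_pos_of_pos_of_nonneg (real_inner_self_pos.mpr hY) (mul_self_nonneg _)
  have γsmul : ∀ x Y (r : ℝ), γ x (r • Y) = r ^ 2 * γ x Y := fun x Y r => by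
    simp only [hγ, inner_smul_left, inner_smul_right, conj_trivial]; ring
  have Ssmul : ∀ x Y (r : ℝ), ⟪fderiv ℝ v x (r • Y), r • Y⟫ = r ^ 2 * ⟪fderiv ℝ v x Y, Y⟫ :=
    fun x Y r => by
      simp only [map_smul, inner_smul_left, inner_smul_right, conj_trivial]; ring
  set D : Set (E × E) := Metric.closedBall 0 R ×ˢ Metric.sphere 0 1 with hD
  have memball : ∀ x : E, x ∈ Metric.closedBall (0 : E) R ↔ ⟪x, x⟫ ≤ R ^ 2 := fun x => by
    rw [mem_closedBall_zero_iff, real_inner_self_eq_norm_sq,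
      sq_le_sq₀ (norm_nonneg x) (by linarith)]
  have hDc : IsCompact D := (isCompact_closedBall 0 R).prod (isCompact_sphere 0 1)
  have hDn : D.Nonempty := ⟨(0, b i₀), by
    simp only [hD, Set.mem_prod, mem_sphere_zero_iff_norm, b.norm_eq_one, and_true]
    simp; linarith⟩
  have normalize : ∀ Y : E, Y ≠ 0 → ∃ r : ℝ, r ≠ 0 ∧ ∃ Y' ∈ Metric.sphere (0 : E) 1, Y = r • Y' := by
    intro Y hY
    refine ⟨‖Y‖, norm_ne_zero_iff.mpr hY, ‖Y‖⁻¹ • Y, ?_, ?_⟩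
    · simp [norm_smul, hY]
    · rw [smul_smul, mul_inv_cancel₀ (norm_ne_zero_iff.mpr hY), one_smul]
  have Dne : ∀ z ∈ D, z.2 ≠ 0 := fun z hz => ne_zero_of_mem_unit_sphere ⟨z.2, hz.2⟩
  have cγ : Continuous fun z : E × E => γ z.1 z.2 := by simp only [hγ]; fun_prop
  have cq : Continuous fun z : E × E => ⟪fderiv ℝ v z.1 z.2, z.2⟫ := by fun_prop
  -- the scale invariant maximum of the Hessian
  obtain ⟨z1, hz1, hmax1⟩ := hDc.exists_isMaxOn hDn (f := fun z : E × E =>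
      (R ^ 2 - ⟪z.1, z.1⟫) * |⟪fderiv ℝ v z.1 z.2, z.2⟫| / γ z.1 z.2)
    (ContinuousOn.div (by fun_prop) cγ.continuousOn fun z hz => (γpos _ _ (Dne z hz)).ne')
  set G := (R ^ 2 - ⟪z1.1, z1.1⟫) * |⟪fderiv ℝ v z1.1 z1.2, z1.2⟫| / γ z1.1 z1.2 with hGdef
  have hG : ∀ x Y, ⟪x, x⟫ ≤ R ^ 2 →
      (R ^ 2 - ⟪x, x⟫) * |⟪fderiv ℝ v x Y, Y⟫| ≤ G * γ x Y := by
    intro x Y hx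
    rcases eq_or_ne Y 0 with rfl | hY
    · simp [hγ]
    obtain ⟨r, -, Y', hY', rfl⟩ := normalize Y hY
    have hne : Y' ≠ 0 := ne_zero_of_mem_unit_sphere ⟨Y', hY'⟩
    have h1 := hmax1 (show (x, Y') ∈ D from ⟨(memball x).mpr hx, hY'⟩)
    have h2 := (div_le_iff₀ (γpos x Y' hne)).mp h1
    rw [γsmul, Ssmul, abs_mul, abs_of_nonneg (sq_nonneg r)]
    linarith [mul_le_mul_of_nonneg_left h2 (sq_nonneg r)]
  have hz1R : ⟪z1.1, z1.1⟫ ≤ R ^ 2 := (memball _).mp hz1.1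
  have hG0 : 0 ≤ G := div_nonneg (mul_nonneg (by linarith) (abs_nonneg _))
    (γpos _ _ (Dne z1 hz1)).le
  refine ⟨G, hG, ?_⟩
  set C := (1 + K) * ((4 * Fintype.card ι + 4 * ‖V‖ + 24 + 8 * (1 + K)) * (R ^ 3 + R * G)) with hC
  have hC0 : 0 < C := by positivity
  obtain ⟨z0, hz0, hmax0⟩ := hDc.exists_isMaxOn hDn (f := fun z : E × E =>
      (R ^ 2 - ⟪z.1, z.1⟫) ^ 2 * ⟪fderiv ℝ v z.1 z.2, z.2⟫ ^ 2 / γ z.1 z.2 ^ 2 +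
        C * ⟪v z.1, v z.1⟫)
    (ContinuousOn.add (ContinuousOn.div (by fun_prop) (cγ.pow 2).continuousOn fun z hz =>
      (pow_pos (γpos _ _ (Dne z hz)) 2).ne') (by fun_prop))
  set P := (R ^ 2 - ⟪z0.1, z0.1⟫) ^ 2 * ⟪fderiv ℝ v z0.1 z0.2, z0.2⟫ ^ 2 / γ z0.1 z0.2 ^ 2 +
        C * ⟪v z0.1, v z0.1⟫ with hP
  have hz0R : ⟪z0.1, z0.1⟫ ≤ R ^ 2 := (memball _).mp hz0.1
  have hmax : ∀ y Y, ⟪y, y⟫ ≤ R ^ 2 → (R ^ 2 - ⟪y, y⟫) ^ 2 * ⟪fderiv ℝ v y Y, Y⟫ ^ 2 +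
      (C * ⟪v y, v y⟫ - P) * γ y Y ^ 2 ≤ 0 := by
    intro y Y hy
    rcases eq_or_ne Y 0 with rfl | hY
    · simp [hγ]
    obtain ⟨r, -, Y', hY', rfl⟩ := normalize Y hY
    have hne : Y' ≠ 0 := ne_zero_of_mem_unit_sphere ⟨Y', hY'⟩
    have h1 := hmax0 (show (y, Y') ∈ D from ⟨(memball y).mpr hy, hY'⟩)
    have h2 := (div_le_iff₀ (pow_pos (γpos y Y' hne) 2)).mp (le_sub_right_of_add_le h1)
    rw [γsmul, Ssmul]
    have := mul_le_mul_of_nonneg_left h2 (sq_nonneg (r ^ 2))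
    simp only at this
    linarith
  have hPK : P ≤ K * C := by
    by_cases hq : (R ^ 2 - ⟪z0.1, z0.1⟫) * ⟪fderiv ℝ v z0.1 z0.2, z0.2⟫ = 0
    · rw [hP, ← mul_pow, hq, zero_pow two_ne_zero, zero_div, zero_add, mul_comm K C]
      exact mul_le_mul_of_nonneg_left (hK z0.1) hC0.le
    exfalso
    obtain ⟨hq1, hq2⟩ := mul_ne_zero_iff.mp hq
    have hlt : ⟪z0.1, z0.1⟫ < R ^ 2 := lt_of_le_of_ne hz0R fun e => hq1 (by rw [e, sub_self])
    have hγ0 := γpos z0.1 _ (Dne z0 hz0)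
    set r := (√(γ z0.1 z0.2))⁻¹ with hr
    have hr2 : r ^ 2 * γ z0.1 z0.2 = 1 := by
      rw [hr, inv_pow, Real.sq_sqrt hγ0.le]; exact inv_mul_cancel₀ hγ0.ne'
    have hr0 : r ^ 2 ≠ 0 := left_ne_zero_of_mul (hr2.trans_ne one_ne_zero)
    have h1 : γ z0.1 (r • z0.2) = 1 := by rw [γsmul, hr2]
    have := h.weight_le (C := C) (P := P) hR h1 hlt hC0.le (hK _)
      (by rw [Ssmul]; exact mul_ne_zero hr0 hq2) (fun Y => hG _ Y hz0R) ?_ ?_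
    · linarith
    · have : ∀ᶠ y in nhds z0.1, ⟪y, y⟫ < R ^ 2 :=
        (by fun_prop : Continuous fun y : E => ⟪y, y⟫).continuousAt.eventually (gt_mem_nhds hlt)
      filter_upwards [this] with y hy Y using hmax y Y hy.le
    · rw [Ssmul, hP]
      have : ((r ^ 2) ^ 2) * γ z0.1 z0.2 ^ 2 = 1 := by rw [← mul_pow, hr2, one_pow]
      field_simp
      linear_combination (R ^ 2 - ⟪z0.1, z0.1⟫) ^ 2 * ⟪fderiv ℝ v z0.1 z0.2, z0.2⟫ ^ 2 * this
  have hGP : G ^ 2 ≤ P := by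
    have h1 : (R ^ 2 - ⟪z1.1, z1.1⟫) ^ 2 * ⟪fderiv ℝ v z1.1 z1.2, z1.2⟫ ^ 2 / γ z1.1 z1.2 ^ 2 +
        C * ⟪v z1.1, v z1.1⟫ ≤ P := hmax0 hz1
    have : 0 ≤ C * ⟪v z1.1, v z1.1⟫ := mul_nonneg hC0.le real_inner_self_nonneg
    rw [hGdef, div_pow, mul_pow, sq_abs]
    linarith
  exact hGP.trans hPK

/-- An entire graph satisfying the translating soliton equation with bounded gradient is affine. -/
theorem fderiv_eq_zero [FiniteDimensional ℝ E] [Nonempty ι] {K : ℝ}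
    (hK : ∀ x, ⟪v x, v x⟫ ≤ K) (x : E) : fderiv ℝ v x = 0 := by
  have hK0 : 0 ≤ K := real_inner_self_nonneg.trans (hK 0)
  set A := K * ((1 + K) * (4 * Fintype.card ι + 4 * ‖V‖ + 24 + 8 * (1 + K))) with hA
  have hA0 : 0 ≤ A := by positivity
  have hx0 : 0 ≤ ⟪x, x⟫ := real_inner_self_nonneg
  have quad : ∀ Y, ⟪fderiv ℝ v x Y, Y⟫ = 0 := by
    intro Y
    set g := ⟪Y, Y⟫ + ⟪v x, Y⟫ * ⟪v x, Y⟫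
    set q := ⟪fderiv ℝ v x Y, Y⟫
    have bound : ∀ R : ℝ, 1 + 2 * ⟪x, x⟫ ≤ R → q ^ 2 * R ≤ 4 * (2 * A + A ^ 2) * g ^ 2 := by
      intro R hR
      have hR1 : 1 ≤ R := by linarith
      have hRR : R ≤ R ^ 2 := by nlinarith
      obtain ⟨G, hG, hG2⟩ := h.exists_hessian_bound hK hR1
      have h1 := hG x Y (by linarith)
      have h2 : R ^ 2 / 2 * |q| ≤ G * g :=
        (mul_le_mul_of_nonneg_right (by linarith) (abs_nonneg _)).trans h1
      have h3 : (R ^ 2 / 2 * |q|) ^ 2 ≤ (G * g) ^ 2 := pow_le_pow_left₀ (by positivity) h2 2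
      rw [mul_pow, sq_abs, mul_pow] at h3
      have h4 : G ^ 2 ≤ A * (R ^ 3 + R * G) := by linarith
      have h5 : R ^ 2 ≤ R ^ 3 := pow_le_pow_right₀ hR1 (by norm_num)
      have h6 : G ^ 2 ≤ (2 * A + A ^ 2) * R ^ 3 := by
        linarith [sq_nonneg (G - A * R), mul_le_mul_of_nonneg_left h5 (sq_nonneg A)]
      have h7 := mul_le_mul_of_nonneg_right h6 (sq_nonneg g)
      refine le_of_mul_le_mul_left ?_ (show 0 < R ^ 3 / 4 by positivity)
      linarith
    by_contra hq
    have hq2 : 0 < q ^ 2 := by positivity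
    obtain ⟨M, hM⟩ : ∃ M, M = 4 * (2 * A + A ^ 2) * g ^ 2 := ⟨_, rfl⟩
    have hM0 : 0 ≤ M := by rw [hM]; positivity
    have := bound (1 + 2 * ⟪x, x⟫ + M / q ^ 2) (by linarith [div_nonneg hM0 hq2.le])
    rw [← hM, mul_add, mul_div_cancel₀ _ hq2.ne'] at this
    nlinarith
  refine ContinuousLinearMap.ext fun p => ext_inner_right ℝ fun r => ?_
  have := quad (p + r)
  simp only [map_add, inner_add_left, inner_add_right, quad, h.symm x r p] at this
  simp only [zero_apply, inner_zero_left]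
  linarith

end IsSolitonGradient
end Soliton

section LocalDiffeomorphism

variable {M H : Type*} [NormedAddCommGroup M] [NormedSpace ℝ M] [CompleteSpace M]
  [NormedAddCommGroup H] [NormedSpace ℝ H] {f : M → H}

theorem exists_openPartialHomeomorph_of_hasFDerivAt_equiv (hf : ContDiff ℝ (⊤ : ℕ∞) f)
    (hf' : ∀ x, ∃ L : M ≃L[ℝ] H, HasFDerivAt f (L : M →L[ℝ] H) x) (x : M) :
    ∃ e : OpenPartialHomeomorph M H, x ∈ e.source ∧ ⇑e = f := by
  obtain ⟨L, hL⟩ := hf' x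
  exact ⟨hf.contDiffAt.toOpenPartialHomeomorph f hL (by simp),
    hf.contDiffAt.mem_toOpenPartialHomeomorph_source hL (by simp), rfl⟩

theorem isLocalHomeomorph_of_hasFDerivAt_equiv (hf : ContDiff ℝ (⊤ : ℕ∞) f)
    (hf' : ∀ x, ∃ L : M ≃L[ℝ] H, HasFDerivAt f (L : M →L[ℝ] H) x) : IsLocalHomeomorph f :=
  fun x => by
    obtain ⟨e, hx, he⟩ := exists_openPartialHomeomorph_of_hasFDerivAt_equiv hf hf' x
    exact ⟨e, hx, he.symm⟩

theorem contDiff_of_comp_of_hasFDerivAt_equiv {A : Type*} [NormedAddCommGroup A] [NormedSpace ℝ A]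
    (hf : ContDiff ℝ (⊤ : ℕ∞) f)
    (hf' : ∀ x, ∃ L : M ≃L[ℝ] H, HasFDerivAt f (L : M →L[ℝ] H) x) {κ : A → M}
    (hκ : Continuous κ) {k : ℕ∞} (hfκ : ContDiff ℝ k (f ∘ κ)) : ContDiff ℝ k κ := by
  rw [contDiff_iff_contDiffAt]
  intro a
  obtain ⟨e, hx, he⟩ := exists_openPartialHomeomorph_of_hasFDerivAt_equiv hf hf' (κ a)
  obtain ⟨L, hL⟩ := hf' (κ a)
  have h1 : ContDiffAt ℝ k e.symm (f (κ a)) := by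
    refine e.contDiffAt_symm (f₀' := L) (by rw [← he]; exact e.map_source hx) ?_ ?_
    · rw [← he, e.left_inv hx, he]; exact hL
    · rw [he]; exact hf.contDiffAt.of_le (by exact_mod_cast le_top)
  have h2 : ContDiffAt ℝ k (e.symm ∘ (f ∘ κ)) a := h1.comp a hfκ.contDiffAt
  refine h2.congr_of_eventuallyEq ?_
  filter_upwards [hκ.continuousAt.preimage_mem_nhds (e.open_source.mem_nhds hx)] with y hy
  simp only [Function.comp, ← he]
  exact (e.left_inv hy).symm

/-- The segment issuing from `f x₀` in the direction `w` lifts along `f` up to time `t`. -/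
def HasSegmentLift (f : M → H) (x₀ : M) (w : H) (t : ℝ) : Prop :=
  ∃ γ : ℝ → M, Continuous γ ∧ γ 0 = x₀ ∧ ∀ s ∈ Set.Icc 0 t, f (γ s) = f x₀ + s • w

omit [NormedSpace ℝ M] [CompleteSpace M] in
theorem HasSegmentLift.mono {x₀ : M} {w : H} {s t : ℝ} (h : HasSegmentLift f x₀ w t)
    (hst : s ≤ t) : HasSegmentLift f x₀ w s := by
  obtain ⟨γ, h1, h2, h3⟩ := h
  exact ⟨γ, h1, h2, fun r hr => h3 r ⟨hr.1, hr.2.trans hst⟩⟩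

omit [NormedSpace ℝ M] [CompleteSpace M] in
theorem hasSegmentLift_zero (f : M → H) (x₀ : M) (w : H) : HasSegmentLift f x₀ w 0 :=
  ⟨fun _ => x₀, continuous_const, rfl, fun s hs => by simp [le_antisymm hs.2 hs.1]⟩

omit [NormedSpace ℝ M] [CompleteSpace M] in
theorem hasSegmentLift_extend {x₀ : M} {w : H} {γ : ℝ → M} {a b : ℝ} (ha : 0 ≤ a) (hab : a ≤ b)
    (hγ : Continuous γ) (h0 : γ 0 = x₀) (hγf : ∀ s ∈ Set.Icc 0 a, f (γ s) = f x₀ + s • w)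
    (e : OpenPartialHomeomorph M H) (he : ⇑e = f) (hs : γ a ∈ e.source)
    (ht : ∀ s ∈ Set.Icc a b, f x₀ + s • w ∈ e.target) : HasSegmentLift f x₀ w b := by
  set r : ℝ → ℝ := fun s => max a (min s b)
  have hr : ∀ s, r s ∈ Set.Icc a b := fun s => ⟨le_max_left _ _, max_le hab (min_le_right _ _)⟩
  refine ⟨fun s => if s ≤ a then γ s else e.symm (f x₀ + r s • w), ?_, by simp [ha, h0], ?_⟩
  · refine Continuous.if_le hγ ?_ continuous_id continuous_const ?_
    · exact e.continuousOn_symm.comp_continuous (by fun_prop) fun s => ht _ (hr s)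
    · rintro s rfl
      have : r s = s := by simp [r, hab]
      rw [this, ← hγf s ⟨ha, le_rfl⟩, ← he, e.left_inv hs]
  · intro s hsb
    dsimp only
    split_ifs with h
    · exact hγf s ⟨hsb.1, h⟩
    · have : r s = s := by simp [r, hsb.2, (not_le.1 h).le]
      rw [this, ← he, e.right_inv, he]
      rw [he]
      exact ht s ⟨(not_le.1 h).le, hsb.2⟩

end LocalDiffeomorphism

section Completeness

variable {n : ℕ} {F : (Fin n → ℝ) → EuclideanSpace ℝ (Fin (n + 1))}
  {H : Type*} [NormedAddCommGroup H] [NormedSpace ℝ H]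
  {P : EuclideanSpace ℝ (Fin (n + 1)) →L[ℝ] H}

theorem indDist_le_length {γ : ℝ → Fin n → ℝ} (hγ : ContDiff ℝ 1 γ) :
    indDist F (γ 0) (γ 1) ≤ ∫ t in (0:ℝ)..1, ‖fderiv ℝ (F ∘ γ) t 1‖ := by
  refine csInf_le ⟨0, ?_⟩ ⟨γ, hγ, rfl, rfl, rfl⟩
  rintro L ⟨γ, -, -, -, rfl⟩
  exact intervalIntegral.integral_nonneg (by norm_num) fun _ _ => norm_nonneg _

theorem exists_path_of_indDist_lt {x y : Fin n → ℝ} {ε : ℝ} (h : indDist F x y < ε) :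
    ∃ γ : ℝ → Fin n → ℝ, ContDiff ℝ 1 γ ∧ γ 0 = x ∧ γ 1 = y ∧
      ∫ t in (0:ℝ)..1, ‖fderiv ℝ (F ∘ γ) t 1‖ < ε := by
  have hne : {L | ∃ γ : ℝ → Fin n → ℝ, ContDiff ℝ 1 γ ∧ γ 0 = x ∧ γ 1 = y ∧
      L = ∫ t in (0:ℝ)..1, ‖fderiv ℝ (F ∘ γ) t 1‖}.Nonempty :=
    ⟨_, fun t => x + t • (y - x), by fun_prop, by simp, by simp, rfl⟩
  obtain ⟨L, ⟨γ, h1, h2, h3, rfl⟩, h4⟩ := exists_lt_of_csInf_lt hne h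
  exact ⟨γ, h1, h2, h3, h4⟩

theorem norm_sub_le_length (hF : ContDiff ℝ (⊤ : ℕ∞) F) (hP : ∀ z, ‖P z‖ ≤ ‖z‖)
    {γ : ℝ → Fin n → ℝ} (hγ : ContDiff ℝ 1 γ) {s : ℝ} (hs : s ∈ Set.Icc (0 : ℝ) 1) :
    ‖P (F (γ 1)) - P (F (γ s))‖ ≤ ∫ t in (0:ℝ)..1, ‖fderiv ℝ (F ∘ γ) t 1‖ := by
  have h1 : ContDiff ℝ 1 (F ∘ γ) := (hF.of_le (by exact_mod_cast le_top)).comp hγ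
  have h2 := intervalIntegral.integral_deriv_of_contDiffOn_Icc (a := s) (b := 1)
    h1.contDiffOn hs.2
  have hc : Continuous fun t => ‖fderiv ℝ (F ∘ γ) t 1‖ :=
    ((h1.continuous_fderiv (by norm_num)).clm_apply continuous_const).norm
  calc ‖P (F (γ 1)) - P (F (γ s))‖ ≤ ‖(F ∘ γ) 1 - (F ∘ γ) s‖ := by
        rw [← map_sub]; exact hP _
    _ ≤ ∫ t in s..1, ‖fderiv ℝ (F ∘ γ) t 1‖ := by
        rw [← h2]; exact intervalIntegral.norm_integral_le_integral_norm hs.2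
    _ ≤ ∫ t in (0:ℝ)..1, ‖fderiv ℝ (F ∘ γ) t 1‖ :=
        intervalIntegral.integral_mono_interval hs.1 hs.2 le_rfl
          (Filter.Eventually.of_forall fun _ => norm_nonneg _) (hc.intervalIntegrable _ _)

theorem norm_sub_le_indDist (hF : ContDiff ℝ (⊤ : ℕ∞) F) (hP : ∀ z, ‖P z‖ ≤ ‖z‖)
    (x y : Fin n → ℝ) : ‖P (F y) - P (F x)‖ ≤ indDist F x y := by
  refine le_of_forall_gt fun ε hε => ?_
  obtain ⟨γ, h1, rfl, rfl, h2⟩ := exists_path_of_indDist_lt hε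
  exact (norm_sub_le_length hF hP h1 (by simp)).trans_lt h2

/-- Points that are close to `x` in the induced distance lie in any given domain of local
invertibility around `x`. -/
theorem mem_source_of_indDist_lt (hF : ContDiff ℝ (⊤ : ℕ∞) F) (hP : ∀ z, ‖P z‖ ≤ ‖z‖)
    (hloc : IsLocalHomeomorph fun x => P (F x))
    (e : OpenPartialHomeomorph (Fin n → ℝ) H) (he : ⇑e = fun x => P (F x))
    {x y : Fin n → ℝ} (hy : y ∈ e.source) {ε : ℝ}
    (hε : Metric.ball (P (F y)) ε ⊆ e.target) (h : indDist F x y < ε) : x ∈ e.source := by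
  obtain ⟨γ, hγ, rfl, rfl, hL⟩ := exists_path_of_indDist_lt h
  have hball : ∀ s ∈ Set.Icc (0 : ℝ) 1, P (F (γ s)) ∈ e.target := fun s hs => hε <| by
    rw [Metric.mem_ball, dist_eq_norm, norm_sub_rev]
    exact (norm_sub_le_length hF hP hγ hs).trans_lt hL
  have key : Set.EqOn γ (fun s => e.symm (P (F (γ s)))) (Set.Icc 0 1) := by
    refine (T2Space.isSeparatedMap _).eqOn_of_comp_eqOn hloc.isLocallyInjective
      isPreconnected_Icc hγ.continuous.continuousOn ?_ ?_ (a := 1) (by simp) ?_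
    · refine e.continuousOn_symm.comp (Continuous.continuousOn ?_) hball
      exact P.continuous.comp (hF.continuous.comp hγ.continuous)
    · intro s hs
      have := e.right_inv (hball s hs)
      simp only [he] at this
      simp [this]
    · have := e.left_inv hy
      simp only [he] at this
      exact this.symm
  rw [key (by simp : (0 : ℝ) ∈ Set.Icc (0 : ℝ) 1)]
  exact e.map_target (hball 0 (by simp))

theorem indDist_le_of_lift (hF : ContDiff ℝ (⊤ : ℕ∞) F)
    (hf' : ∀ x, ∃ L : (Fin n → ℝ) ≃L[ℝ] H,
      HasFDerivAt (fun x => P (F x)) (L : (Fin n → ℝ) →L[ℝ] H) x) {B : ℝ}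
    (hFB : ∀ x h, ‖fderiv ℝ F x h‖ ≤ B * ‖P (fderiv ℝ F x h)‖)
    {p w : H} {t : ℝ} {γ : ℝ → Fin n → ℝ} (hγ : Continuous γ)
    (hγf : ∀ s ∈ Set.Icc 0 t, P (F (γ s)) = p + s • w) {a b : ℝ} (ha : a ∈ Set.Icc 0 t)
    (hb : b ∈ Set.Icc 0 t) :
    indDist F (γ a) (γ b) ≤
      (B * ‖w‖ * ∫ s in (0:ℝ)..1, |deriv Real.smoothTransition s|) * |b - a| := by
  set κ : ℝ → Fin n → ℝ := fun s => γ (a + (b - a) * Real.smoothTransition s) with hκ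
  have hsm : ContDiff ℝ 1 Real.smoothTransition := Real.smoothTransition.contDiff
  have hmem : ∀ s, a + (b - a) * Real.smoothTransition s ∈ Set.Icc 0 t := fun s => by
    have h0 := Real.smoothTransition.nonneg s
    have h1 := Real.smoothTransition.le_one s
    constructor <;> nlinarith [ha.1, ha.2, hb.1, hb.2]
  have hfκ : (fun s => P (F (κ s))) = fun s => p + (a + (b - a) * Real.smoothTransition s) • w :=
    funext fun s => hγf _ (hmem s)
  have hκc : Continuous κ := hγ.comp (by have := hsm.continuous; fun_prop)
  have hf : ContDiff ℝ (⊤ : ℕ∞) fun x => P (F x) := P.contDiff.comp hF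
  have hκ1 : ContDiff ℝ 1 κ := by
    refine contDiff_of_comp_of_hasFDerivAt_equiv (k := 1) hf hf' hκc ?_
    change ContDiff ℝ _ (fun s => P (F (κ s)))
    rw [hfκ]
    exact contDiff_const.add ((contDiff_const.add (contDiff_const.mul hsm)).smul contDiff_const)
  have hFκ : ContDiff ℝ 1 (F ∘ κ) := (hF.of_le (by exact_mod_cast le_top)).comp hκ1
  have hd : ∀ s, P (fderiv ℝ (F ∘ κ) s 1) = ((b - a) * deriv Real.smoothTransition s) • w := by
    intro s
    have h1 : HasDerivAt (fun s => P (F (κ s))) (P (fderiv ℝ (F ∘ κ) s 1)) s :=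
      (P.hasFDerivAt.comp s
        (hFκ.differentiable (by norm_num) s).hasFDerivAt).hasDerivAt
    have h2 := (hsm.differentiable (by norm_num) s).hasDerivAt
    rw [hfκ] at h1
    exact h1.unique ((((h2.const_mul (b - a)).const_add a).smul_const w).const_add p)
  have hpt : ∀ s, ‖fderiv ℝ (F ∘ κ) s 1‖ ≤
      B * ‖w‖ * |b - a| * |deriv Real.smoothTransition s| := by
    intro s
    have h1 : fderiv ℝ (F ∘ κ) s 1 = fderiv ℝ F (κ s) (fderiv ℝ κ s 1) := by
      rw [fderiv_comp s (hF.differentiable (by simp) _) (hκ1.differentiable (by norm_num) s)]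
      rfl
    have h2 := hFB (κ s) (fderiv ℝ κ s 1)
    rw [← h1, hd, norm_smul, Real.norm_eq_abs, abs_mul] at h2
    linarith
  have h01 : κ 0 = γ a ∧ κ 1 = γ b := by simp [hκ]
  rw [← h01.1, ← h01.2]
  refine (indDist_le_length hκ1).trans ?_
  have hcd : Continuous (deriv Real.smoothTransition) := hsm.continuous_deriv le_rfl
  calc _ ≤ ∫ s in (0:ℝ)..1, B * ‖w‖ * |b - a| * |deriv Real.smoothTransition s| := by
        refine intervalIntegral.integral_mono_on (by norm_num) ?_ ?_ fun s _ => hpt s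
        · exact (((hFκ.continuous_fderiv (by norm_num)).clm_apply
            continuous_const).norm).intervalIntegrable _ _
        · exact (continuous_const.mul hcd.abs).intervalIntegrable _ _
    _ = _ := by rw [intervalIntegral.integral_const_mul]; ring

theorem exists_hasSegmentLift_gt (hF : ContDiff ℝ (⊤ : ℕ∞) F) (hP : ∀ z, ‖P z‖ ≤ ‖z‖)
    (hf' : ∀ x, ∃ L : (Fin n → ℝ) ≃L[ℝ] H,
      HasFDerivAt (fun x => P (F x)) (L : (Fin n → ℝ) →L[ℝ] H) x) {B : ℝ}
    (hFB : ∀ x h, ‖fderiv ℝ F x h‖ ≤ B * ‖P (fderiv ℝ F x h)‖)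
    (hcomplete : ∀ s : ℕ → Fin n → ℝ,
      (∀ ε > 0, ∃ N, ∀ p ≥ N, ∀ q ≥ N, indDist F (s p) (s q) < ε) →
      ∃ x, ∀ ε > 0, ∃ N, ∀ p ≥ N, indDist F (s p) x < ε)
    {x₀ : Fin n → ℝ} {w : H} {t : ℝ} (ht0 : 0 ≤ t)
    (ht : ∀ s, 0 ≤ s → s < t → HasSegmentLift (fun x => P (F x)) x₀ w s) :
    ∃ t' > t, HasSegmentLift (fun x => P (F x)) x₀ w t' := by
  have hf : ContDiff ℝ (⊤ : ℕ∞) fun x => P (F x) := P.contDiff.comp hF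
  have hloc := isLocalHomeomorph_of_hasFDerivAt_equiv hf hf'
  obtain ⟨r, hr0, hrt, hrlim⟩ : ∃ r : ℕ → ℝ, (∀ k, 0 ≤ r k) ∧ (∀ k, r k ≤ t ∧ (r k = 0 ∨ r k < t)) ∧
      Filter.Tendsto r Filter.atTop (nhds t) := by
    refine ⟨fun k => t * (1 - 1 / ((k : ℝ) + 1)), fun k => ?_, fun k => ?_, ?_⟩
    · have : 1 / ((k : ℝ) + 1) ≤ 1 := by
        rw [div_le_one (by positivity)]; linarith [(Nat.cast_nonneg k : (0 : ℝ) ≤ k)]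
      exact mul_nonneg ht0 (by linarith)
    · have : 0 < 1 / ((k : ℝ) + 1) := by positivity
      refine ⟨by nlinarith, ?_⟩
      rcases ht0.eq_or_lt with h | h
      · left; simp [← h]
      · right; nlinarith
    · have := (tendsto_one_div_add_atTop_nhds_zero_nat (𝕜 := ℝ)).const_sub 1 |>.const_mul t
      simpa using this
  have hlift : ∀ k, HasSegmentLift (fun x => P (F x)) x₀ w (r k) := fun k => by
    rcases (hrt k).2 with h | h
    · rw [h]; exact hasSegmentLift_zero _ _ _
    · exact ht _ (hr0 k) h
  choose γ hγc hγ0 hγf using hlift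
  have hagree : ∀ j k, r j ≤ r k → γ j (r j) = γ k (r j) := fun j k hjk => by
    refine (T2Space.isSeparatedMap _).eqOn_of_comp_eqOn hloc.isLocallyInjective
      (isPreconnected_Icc (a := 0) (b := r j)) (hγc j).continuousOn (hγc k).continuousOn ?_
      (a := 0) ⟨le_rfl, hr0 j⟩ ((hγ0 j).trans (hγ0 k).symm) ⟨hr0 j, le_rfl⟩
    intro s hs
    exact (hγf j s hs).trans (hγf k s ⟨hs.1, hs.2.trans hjk⟩).symm
  set C := B * ‖w‖ * ∫ s in (0:ℝ)..1, |deriv Real.smoothTransition s|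
  have hdist : ∀ j k, indDist F (γ j (r j)) (γ k (r k)) ≤ C * |r k - r j| := fun j k => by
    rcases le_total (r j) (r k) with h | h
    · rw [hagree j k h]
      exact indDist_le_of_lift hF hf' hFB (hγc k) (hγf k) ⟨hr0 j, h⟩ ⟨hr0 k, le_rfl⟩
    · rw [hagree k j h]
      exact indDist_le_of_lift hF hf' hFB (hγc j) (hγf j) ⟨hr0 j, le_rfl⟩ ⟨hr0 k, h⟩
  obtain ⟨x, hx⟩ := hcomplete (fun k => γ k (r k)) fun ε hε => by
    obtain ⟨N, hN⟩ := Metric.cauchySeq_iff.1 hrlim.cauchySeq (ε / (|C| + 1)) (by positivity)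
    refine ⟨N, fun p hp q hq => ?_⟩
    have h1 := hN q hq p hp
    rw [Real.dist_eq, lt_div_iff₀ (by positivity)] at h1
    calc _ ≤ C * |r q - r p| := hdist p q
      _ ≤ |C| * |r q - r p| := by gcongr; exact le_abs_self C
      _ ≤ |r q - r p| * (|C| + 1) := by nlinarith [abs_nonneg (r q - r p)]
      _ < ε := h1
  have hlim : Filter.Tendsto (fun k => P (F (γ k (r k)))) Filter.atTop (nhds (P (F x))) := by
    rw [Metric.tendsto_atTop]
    intro ε hε
    obtain ⟨N, hN⟩ := hx ε hε
    refine ⟨N, fun k hk => ?_⟩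
    rw [dist_eq_norm, norm_sub_rev]
    exact (norm_sub_le_indDist hF hP _ _).trans_lt (hN k hk)
  have hxt : P (F x) = P (F x₀) + t • w := by
    refine tendsto_nhds_unique hlim ?_
    simp only [fun k => hγf k (r k) ⟨hr0 k, le_rfl⟩]
    exact (hrlim.smul_const w).const_add _
  obtain ⟨e, hxe, he⟩ := exists_openPartialHomeomorph_of_hasFDerivAt_equiv hf hf' x
  have htar : P (F x) ∈ e.target := by
    have := e.map_source hxe
    rwa [he] at this
  obtain ⟨ε, hε, hball⟩ := Metric.isOpen_iff.1 e.open_target _ htar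
  obtain ⟨δ, hδ, hδw⟩ : ∃ δ > 0, δ * ‖w‖ < ε :=
    ⟨ε / (‖w‖ + 1), by positivity, by
      rw [div_mul_eq_mul_div, div_lt_iff₀ (by positivity)]; nlinarith [norm_nonneg w]⟩
  obtain ⟨N, hN⟩ := hx ε hε
  obtain ⟨N', hN'⟩ := Metric.tendsto_atTop.1 hrlim δ hδ
  set k := max N N'
  have hk := hN' k (le_max_right _ _)
  rw [Real.dist_eq, abs_lt] at hk
  refine ⟨t + δ, by linarith, hasSegmentLift_extend (hr0 k) (by linarith [(hrt k).1]) (hγc k)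
    (hγ0 k) (hγf k) e he
    (mem_source_of_indDist_lt hF hP hloc e he hxe hball (hN k (le_max_left _ _))) ?_⟩
  intro s hs
  refine hball ?_
  rw [Metric.mem_ball, dist_eq_norm, hxt, add_sub_add_left_eq_sub, ← sub_smul, norm_smul]
  refine lt_of_le_of_lt (mul_le_mul_of_nonneg_right ?_ (norm_nonneg w)) hδw
  rw [Real.norm_eq_abs, abs_le]
  constructor <;> linarith [hs.1, hs.2]

theorem hasSegmentLift_of_complete (hF : ContDiff ℝ (⊤ : ℕ∞) F) (hP : ∀ z, ‖P z‖ ≤ ‖z‖)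
    (hf' : ∀ x, ∃ L : (Fin n → ℝ) ≃L[ℝ] H,
      HasFDerivAt (fun x => P (F x)) (L : (Fin n → ℝ) →L[ℝ] H) x) {B : ℝ}
    (hFB : ∀ x h, ‖fderiv ℝ F x h‖ ≤ B * ‖P (fderiv ℝ F x h)‖)
    (hcomplete : ∀ s : ℕ → Fin n → ℝ,
      (∀ ε > 0, ∃ N, ∀ p ≥ N, ∀ q ≥ N, indDist F (s p) (s q) < ε) →
      ∃ x, ∀ ε > 0, ∃ N, ∀ p ≥ N, indDist F (s p) x < ε)
    (x₀ : Fin n → ℝ) (w : H) (t : ℝ) : HasSegmentLift (fun x => P (F x)) x₀ w t := by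
  by_contra hcon
  set S := {s | HasSegmentLift (fun x => P (F x)) x₀ w s}
  have hS0 : (0 : ℝ) ∈ S := hasSegmentLift_zero (fun x => P (F x)) x₀ w
  have hbdd : BddAbove S :=
    ⟨t, fun s hs => not_lt.1 fun hlt => hcon (HasSegmentLift.mono hs hlt.le)⟩
  obtain ⟨t', ht', hlift⟩ := exists_hasSegmentLift_gt hF hP hf' hFB hcomplete
    (le_csSup hbdd hS0) (x₀ := x₀) (w := w) fun s _ hs => by
      obtain ⟨r, hr, hsr⟩ := exists_lt_of_lt_csSup ⟨0, hS0⟩ hs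
      exact HasSegmentLift.mono hr hsr.le
  exact absurd (le_csSup hbdd hlift) (not_le.2 ht')

/-- Hadamard's theorem for the projection of a complete immersion to a hyperplane over which its
tangent planes are uniformly graphical. -/
theorem exists_smooth_inverse (hF : ContDiff ℝ (⊤ : ℕ∞) F) (hP : ∀ z, ‖P z‖ ≤ ‖z‖)
    (hf' : ∀ x, ∃ L : (Fin n → ℝ) ≃L[ℝ] H,
      HasFDerivAt (fun x => P (F x)) (L : (Fin n → ℝ) →L[ℝ] H) x) {B : ℝ}
    (hFB : ∀ x h, ‖fderiv ℝ F x h‖ ≤ B * ‖P (fderiv ℝ F x h)‖)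
    (hcomplete : ∀ s : ℕ → Fin n → ℝ,
      (∀ ε > 0, ∃ N, ∀ p ≥ N, ∀ q ≥ N, indDist F (s p) (s q) < ε) →
      ∃ x, ∀ ε > 0, ∃ N, ∀ p ≥ N, indDist F (s p) x < ε) :
    ∃ σ : H → Fin n → ℝ, ContDiff ℝ (⊤ : ℕ∞) σ ∧ (∀ z, P (F (σ z)) = z) ∧
      ∀ x, σ (P (F x)) = x := by
  have hf : ContDiff ℝ (⊤ : ℕ∞) fun x => P (F x) := P.contDiff.comp hF
  have hloc := isLocalHomeomorph_of_hasFDerivAt_equiv hf hf'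
  have hsep : IsSeparatedMap fun x => P (F x) := T2Space.isSeparatedMap _
  choose γ hγc hγ0 hγf using fun a =>
    hasSegmentLift_of_complete hF hP hf' hFB hcomplete 0 (a - P (F 0)) 1
  have hcont : Continuous fun z : unitInterval × H => γ z.2 z.1 := by
    refine hloc.continuous_lift hsep
      ⟨fun z : unitInterval × H => P (F 0) + (z.1 : ℝ) • (z.2 - P (F 0)), by fun_prop⟩ ?_ ?_ ?_
    · funext z
      exact hγf z.2 z.1 z.1.2
    · simp only [Set.Icc.coe_zero, hγ0]
      exact continuous_const
    · exact fun a => (hγc a).comp continuous_subtype_val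
  have hσ : Continuous fun a => γ a 1 := hcont.comp (Continuous.prodMk_right (1 : unitInterval))
  have hright : ∀ a, P (F (γ a 1)) = a := fun a => by
    have := hγf a 1 (by simp)
    rwa [one_smul, add_sub_cancel] at this
  refine ⟨fun a => γ a 1, ?_, hright, fun x => ?_⟩
  · refine contDiff_of_comp_of_hasFDerivAt_equiv hf hf' hσ ?_
    have : (fun x => P (F x)) ∘ (fun a => γ a 1) = id := funext hright
    rw [this]
    exact contDiff_id
  · have h : (fun x => γ (P (F x)) 1) = id :=
      hsep.eq_of_comp_eq hloc.isLocallyInjective (hσ.comp hf.continuous) continuous_id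
        (funext fun x => hright (P (F x))) (γ 0 1) (by simp only [id, hright])
    exact congrFun h x

end Completeness

section Frame

variable {E : Type*} [NormedAddCommGroup E] [InnerProductSpace ℝ E] {ι : Type*} [Fintype ι]

theorem inner_tiltedFrame [DecidableEq ι] (b : OrthonormalBasis ι ℝ E) (v : E) (i j : ι) :
    ⟪tiltedFrame b v i, tiltedFrame b v j⟫ + ⟪v, tiltedFrame b v i⟫ * ⟪v, tiltedFrame b v j⟫ =
      if i = j then 1 else 0 := by
  have hw : 0 < 1 + ‖v‖ ^ 2 := by positivity
  have hw2 : √(1 + ‖v‖ ^ 2) ^ 2 = 1 + ‖v‖ ^ 2 := Real.sq_sqrt hw.le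
  have hwpos : 0 < √(1 + ‖v‖ ^ 2) := Real.sqrt_pos.mpr hw
  simp only [tiltedFrame]
  set w := √(1 + ‖v‖ ^ 2)
  have hvv : ⟪v, v⟫ = w ^ 2 - 1 := by rw [real_inner_self_eq_norm_sq]; linarith
  simp only [inner_sub_left, inner_sub_right, inner_smul_left, inner_smul_right, conj_trivial,
    real_inner_comm v (b i), hvv, b.inner_eq_ite]
  rw [← sub_eq_zero]
  field_simp
  ring

end Frame

section MeanCurvature

variable {n : ℕ} {F ν : (Fin n → ℝ) → EuclideanSpace ℝ (Fin (n + 1))}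

theorem fderiv_eq_sum_pdv (x h : Fin n → ℝ) : fderiv ℝ F x h = ∑ i, h i • pdv i F x := by
  conv_lhs => rw [pi_eq_sum_univ' h, map_sum]
  simp only [map_smul, pdv]

theorem inner_fderiv_eq_zero (horth : ∀ x i, ⟪ν x, pdv i F x⟫ = 0) (x h : Fin n → ℝ) :
    ⟪ν x, fderiv ℝ F x h⟫ = 0 := by
  simp [fderiv_eq_sum_pdv, inner_sum, inner_smul_right, horth]

theorem injective_fderiv (himm : ∀ x, (gmet F x).det ≠ 0) (x : Fin n → ℝ) :
    Function.Injective (fderiv ℝ F x) := by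
  rw [injective_iff_map_eq_zero]
  intro h hh
  refine Matrix.eq_zero_of_mulVec_eq_zero (himm x) (funext fun i => ?_)
  rw [fderiv_eq_sum_pdv] at hh
  have := congrArg (fun z => ⟪pdv i F x, z⟫) hh
  simp only [inner_sum, inner_smul_right, inner_zero_right] at this
  simp only [Matrix.mulVec, dotProduct, gmet, Matrix.of_apply, Pi.zero_apply]
  rw [← this]
  exact Finset.sum_congr rfl fun j _ => mul_comm _ _

theorem sff_eq_inner_fderiv (hF : ContDiff ℝ (⊤ : ℕ∞) F) (hν : ContDiff ℝ (⊤ : ℕ∞) ν)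
    (horth : ∀ x i, ⟪ν x, pdv i F x⟫ = 0) (x : Fin n → ℝ) (i j : Fin n) :
    sff F ν x i j = ⟪fderiv ℝ ν x (Pi.single i 1), fderiv ℝ F x (Pi.single j 1)⟫ := by
  have h1 : DifferentiableAt ℝ (fun y => pdv j F y) x :=
    (((contDiff_top_fderiv hF).clm_apply contDiff_const).differentiable (by simp)) x
  have h2 := fderiv_inner_apply ℝ (hν.differentiable (by simp) x) h1 (Pi.single i 1)
  simp only [horth, fderiv_fun_const, Pi.zero_apply, zero_apply] at h2
  rw [sff, real_inner_comm (ν x)]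
  simp only [pdv] at h2 ⊢
  linarith

theorem meanCurv_eq_sum (hF : ContDiff ℝ (⊤ : ℕ∞) F) (hν : ContDiff ℝ (⊤ : ℕ∞) ν)
    (horth : ∀ x i, ⟪ν x, pdv i F x⟫ = 0) (x : Fin n → ℝ) {p : Fin n → Fin n → ℝ}
    (hp : ∀ k l, ⟪fderiv ℝ F x (p k), fderiv ℝ F x (p l)⟫ = if k = l then 1 else 0) :
    meanCurv F ν x = ∑ k, ⟪fderiv ℝ ν x (p k), fderiv ℝ F x (p k)⟫ := by
  set A : Matrix (Fin n) (Fin n) ℝ := Matrix.of fun i k => p k i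
  have h1 : A.transpose * gmet F x * A = 1 := by
    ext k l
    rw [Matrix.one_apply, ← hp, fderiv_eq_sum_pdv x (p k), fderiv_eq_sum_pdv x (p l), sum_inner]
    simp only [inner_sum, Matrix.mul_apply, Matrix.transpose_apply, Matrix.of_apply, gmet, A,
      inner_smul_left, inner_smul_right, conj_trivial, Finset.sum_mul]
    rw [Finset.sum_comm]
    exact Finset.sum_congr rfl fun i _ => Finset.sum_congr rfl fun j _ => by ring
  have h2 : (gmet F x)⁻¹ = A * A.transpose := by
    refine Matrix.inv_eq_left_inv ?_
    rw [mul_assoc]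
    exact mul_eq_one_comm.1 h1
  have h3 : ∀ k, ⟪fderiv ℝ ν x (p k), fderiv ℝ F x (p k)⟫ =
      ∑ i, ∑ j, p k i * p k j * sff F ν x i j := by
    intro k
    rw [fderiv_eq_sum_pdv (F := ν), fderiv_eq_sum_pdv (F := F), sum_inner]
    simp only [inner_sum, inner_smul_left, inner_smul_right, conj_trivial,
      sff_eq_inner_fderiv hF hν horth]
    exact Finset.sum_congr rfl fun i _ => Finset.sum_congr rfl fun j _ => by
      simp only [pdv]; ring
  simp only [h3, meanCurv, h2, Matrix.mul_apply, Matrix.transpose_apply, Matrix.of_apply, A,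
    Finset.sum_mul]
  rw [Finset.sum_comm]
  conv_rhs => rw [Finset.sum_comm]
  rw [Finset.sum_comm]
  refine Finset.sum_congr rfl fun i _ => ?_
  rw [Finset.sum_comm]

end MeanCurvature

section Graph

variable {E H : Type*} [NormedAddCommGroup E] [InnerProductSpace ℝ E]
  [NormedAddCommGroup H] [InnerProductSpace ℝ H] {P : E →L[ℝ] H} {y : E} {G N : H → E}

/-- The gradient of the height function of a graph in the direction `y` over the target of the
projection `P`, in terms of a normal field `N`. -/
def graphGradient (P : E →L[ℝ] H) (y : E) (N : H → E) (z : H) : H :=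
  -(⟪y, N z⟫⁻¹ • P (N z))

theorem smul_graphGradient {z : H} (hpos : 0 < ⟪y, N z⟫) :
    P (N z) = -(⟪y, N z⟫ • graphGradient P y N z) := by
  rw [graphGradient, smul_neg, neg_neg, smul_smul, mul_inv_cancel₀ hpos.ne', one_smul]

variable (hP : ∀ p q, ⟪p, q⟫ = ⟪P p, P q⟫ + ⟪y, p⟫ * ⟪y, q⟫)
include hP

theorem inner_graphGradient_self {z : H} (hpos : 0 < ⟪y, N z⟫) (hN : ‖N z‖ = 1) :
    ⟪y, N z⟫ ^ 2 * (1 + ⟪graphGradient P y N z, graphGradient P y N z⟫) = 1 := by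
  have h1 := hP (N z) (N z)
  rw [real_inner_self_eq_norm_sq, hN, smul_graphGradient hpos] at h1
  simp only [inner_neg_left, inner_neg_right, inner_smul_left, inner_smul_right,
    conj_trivial] at h1
  linarith

variable (hG : ContDiff ℝ (⊤ : ℕ∞) G) (hPG : ∀ z, P (G z) = z)
  (horth : ∀ z a, ⟪N z, fderiv ℝ G z a⟫ = 0) (hpos : ∀ z, 0 < ⟪y, N z⟫)

omit hP in
include hG hPG in
theorem map_fderiv_graph (z a : H) : P (fderiv ℝ G z a) = a := by
  have h1 : HasFDerivAt (fun z => P (G z)) (P ∘L fderiv ℝ G z) z :=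
    P.hasFDerivAt.comp z (hG.differentiable (by simp) z).hasFDerivAt
  simp only [hPG] at h1
  exact congrArg (fun L => L a) (h1.unique (hasFDerivAt_id z))

include hG hPG horth hpos in
theorem inner_fderiv_graph (z a : H) : ⟪y, fderiv ℝ G z a⟫ = ⟪graphGradient P y N z, a⟫ := by
  have h1 := hP (N z) (fderiv ℝ G z a)
  rw [horth, map_fderiv_graph hG hPG, smul_graphGradient (hpos z), inner_neg_left,
    inner_smul_left, conj_trivial] at h1
  refine mul_left_cancel₀ (hpos z).ne' ?_
  linarith

include hG hPG horth hpos in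
theorem inner_fderiv_graph_fderiv_graph (z a c : H) : ⟪fderiv ℝ G z a, fderiv ℝ G z c⟫ =
    ⟪a, c⟫ + ⟪graphGradient P y N z, a⟫ * ⟪graphGradient P y N z, c⟫ := by
  rw [hP, map_fderiv_graph hG hPG, map_fderiv_graph hG hPG,
    inner_fderiv_graph hP hG hPG horth hpos, inner_fderiv_graph hP hG hPG horth hpos]

omit hP in
include hpos in
theorem contDiff_graphGradient (hN : ContDiff ℝ (⊤ : ℕ∞) N) :
    ContDiff ℝ (⊤ : ℕ∞) (graphGradient P y N) :=
  (((contDiff_const.inner ℝ hN).inv fun z => (hpos z).ne').smul (P.contDiff.comp hN)).neg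

include hG hPG horth hpos in
theorem inner_fderiv_graphGradient_comm (hN : ContDiff ℝ (⊤ : ℕ∞) N) (z a c : H) :
    ⟪fderiv ℝ (graphGradient P y N) z a, c⟫ = ⟪fderiv ℝ (graphGradient P y N) z c, a⟫ := by
  have hv : DifferentiableAt ℝ (graphGradient P y N) z :=
    (contDiff_graphGradient (P := P) hpos hN).differentiable (by simp) z
  have key : ∀ a c, ⟪fderiv ℝ (graphGradient P y N) z a, c⟫ =
      ⟪y, fderiv ℝ (fderiv ℝ G) z a c⟫ := by
    intro a c
    have h1 : HasFDerivAt (fun z => ⟪graphGradient P y N z, c⟫)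
        ((innerSL ℝ c) ∘L fderiv ℝ (graphGradient P y N) z) z := by
      simpa only [Function.comp_def, innerSL_apply_apply, real_inner_comm] using
        (innerSL ℝ c).hasFDerivAt.comp z hv.hasFDerivAt
    have h2 : HasFDerivAt (fun z => ⟪y, fderiv ℝ G z c⟫)
        ((innerSL ℝ y) ∘L ((ContinuousLinearMap.apply ℝ E c) ∘L fderiv ℝ (fderiv ℝ G) z)) z :=
      (innerSL ℝ y).hasFDerivAt.comp z ((ContinuousLinearMap.apply ℝ E c).hasFDerivAt.comp z
        ((contDiff_top_fderiv hG).differentiable (by simp) z).hasFDerivAt)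
    simp only [inner_fderiv_graph hP hG hPG horth hpos] at h2
    have := congrArg (fun L => L a) (h1.unique h2)
    simp only [ContinuousLinearMap.comp_apply, innerSL_apply_apply,
      ContinuousLinearMap.apply_apply] at this
    rw [← this, real_inner_comm]
  rw [key, key, fderiv_fderiv_comm hG]

include hG hPG horth hpos in
theorem inner_fderiv_normal_fderiv_graph (hN : ContDiff ℝ (⊤ : ℕ∞) N) (z a c : H) :
    ⟪fderiv ℝ N z a, fderiv ℝ G z c⟫ =
      -(⟪y, N z⟫ * ⟪fderiv ℝ (graphGradient P y N) z a, c⟫) := by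
  have hv : HasFDerivAt (graphGradient P y N) (fderiv ℝ (graphGradient P y N) z) z :=
    ((contDiff_graphGradient (P := P) hpos hN).differentiable (by simp) z).hasFDerivAt
  have hN' : HasFDerivAt N (fderiv ℝ N z) z := (hN.differentiable (by simp) z).hasFDerivAt
  have h1 : HasFDerivAt (fun z => P (N z)) (P ∘L fderiv ℝ N z) z := P.hasFDerivAt.comp z hN'
  have h2 : HasFDerivAt (fun z => ⟪y, N z⟫) ((innerSL ℝ y) ∘L fderiv ℝ N z) z :=
    (innerSL ℝ y).hasFDerivAt.comp z hN'
  have h3 := (h2.smul hv).neg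
  have h4 : (fun z => P (N z)) = -((fun z => ⟪y, N z⟫) • graphGradient P y N) :=
    funext fun z => smul_graphGradient (hpos z)
  rw [h4] at h1
  have h5 := congrArg (fun L => L a) (h1.unique h3)
  simp only [ContinuousLinearMap.comp_apply, neg_apply,
    add_apply, smul_apply,
    ContinuousLinearMap.smulRight_apply, innerSL_apply_apply] at h5
  rw [hP, map_fderiv_graph hG hPG, inner_fderiv_graph hP hG hPG horth hpos, h5]
  simp only [inner_neg_left, inner_add_left, inner_smul_left, conj_trivial]
  ring

end Graph

section Bernstein

variable {n : ℕ} {F ν : (Fin n → ℝ) → EuclideanSpace ℝ (Fin (n + 1))}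
  {y T : EuclideanSpace ℝ (Fin (n + 1))}
  {H : Type*} [NormedAddCommGroup H] [InnerProductSpace ℝ H]
  {P : EuclideanSpace ℝ (Fin (n + 1)) →L[ℝ] H}

theorem isSolitonGradient_graphGradient (hF : ContDiff ℝ (⊤ : ℕ∞) F)
    (hν : ContDiff ℝ (⊤ : ℕ∞) ν) (horth : ∀ x i, ⟪ν x, pdv i F x⟫ = 0)
    (hsol : ∀ x, ⟪T, ν x⟫ = -meanCurv F ν x) (hpos : ∀ x, 0 < ⟪y, ν x⟫)
    (hP : ∀ p q, ⟪p, q⟫ = ⟪P p, P q⟫ + ⟪y, p⟫ * ⟪y, q⟫) (b : OrthonormalBasis (Fin n) ℝ H)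
    {σ : H → Fin n → ℝ} (hσ : ContDiff ℝ (⊤ : ℕ∞) σ) (hPσ : ∀ z, P (F (σ z)) = z) :
    IsSolitonGradient b (graphGradient P y (ν ∘ σ)) (P T) ⟪y, T⟫ := by
  have hG : ContDiff ℝ (⊤ : ℕ∞) (F ∘ σ) := hF.comp hσ
  have hN : ContDiff ℝ (⊤ : ℕ∞) (ν ∘ σ) := hν.comp hσ
  have hcomp : ∀ {Φ : (Fin n → ℝ) → EuclideanSpace ℝ (Fin (n + 1))}, ContDiff ℝ (⊤ : ℕ∞) Φ →
      ∀ z a, fderiv ℝ (Φ ∘ σ) z a = fderiv ℝ Φ (σ z) (fderiv ℝ σ z a) := fun hΦ z a => by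
    rw [fderiv_comp z (hΦ.differentiable (by simp) _) (hσ.differentiable (by simp) z)]
    rfl
  have hGN : ∀ z a, ⟪(ν ∘ σ) z, fderiv ℝ (F ∘ σ) z a⟫ = 0 := fun z a => by
    rw [hcomp hF]; exact inner_fderiv_eq_zero horth _ _
  have hposN : ∀ z, 0 < ⟪y, (ν ∘ σ) z⟫ := fun z => hpos (σ z)
  refine ⟨contDiff_graphGradient hposN hN,
    inner_fderiv_graphGradient_comm hP hG hPσ hGN hposN hN, fun z => ?_⟩
  set v := graphGradient P y (ν ∘ σ) with hv
  have h1 : meanCurv F ν (σ z) = ∑ k, ⟪fderiv ℝ (ν ∘ σ) z (tiltedFrame b (v z) k),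
      fderiv ℝ (F ∘ σ) z (tiltedFrame b (v z) k)⟫ := by
    rw [meanCurv_eq_sum hF hν horth (σ z)
      (p := fun k => fderiv ℝ σ z (tiltedFrame b (v z) k)) fun k l => ?_]
    · simp only [hcomp hF, hcomp hν]
    · rw [← hcomp hF, ← hcomp hF, inner_fderiv_graph_fderiv_graph hP hG hPσ hGN hposN,
        inner_tiltedFrame]
  have h2 := sum_tiltedFrame b (v z) (LinearMap.mk₂ ℝ (fun p q : H => ⟪fderiv ℝ v z p, q⟫)
    (fun _ _ _ => by simp [inner_add_left]) (fun _ _ _ => by simp [inner_smul_left])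
    (fun _ _ _ => by simp [inner_add_right]) (fun _ _ _ => by simp [inner_smul_right]))
  simp only [LinearMap.mk₂_apply] at h2
  simp only [inner_fderiv_normal_fderiv_graph hP hG hPσ hGN hposN hN, ← hv,
    Finset.sum_neg_distrib, ← Finset.mul_sum, h2] at h1
  have h3 := hsol (σ z)
  rw [h1, neg_neg, hP] at h3
  have h4 : P (ν (σ z)) = -(⟪y, ν (σ z)⟫ • v z) := smul_graphGradient (hposN z)
  rw [h4, inner_neg_right, inner_smul_right] at h3
  have h5 : ⟪y, T⟫ - ⟪P T, v z⟫ = ∑ i, ⟪fderiv ℝ v z (b i), b i⟫ -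
      (1 + ‖v z‖ ^ 2)⁻¹ * ⟪fderiv ℝ v z (v z), v z⟫ := by
    refine mul_left_cancel₀ (hpos (σ z)).ne' ?_
    simp only [Function.comp] at h3
    linarith
  have h6 : (0 : ℝ) < 1 + ‖v z‖ ^ 2 := by positivity
  rw [real_inner_self_eq_norm_sq]
  field_simp at h5
  linear_combination -h5

theorem norm_fderiv_le {c : ℝ} (hc : 0 < c) (hν : ∀ x, c ≤ ⟪y, ν x⟫) (hunit : ∀ x, ‖ν x‖ = 1)
    (horth : ∀ x i, ⟪ν x, pdv i F x⟫ = 0)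
    (hP : ∀ p q, ⟪p, q⟫ = ⟪P p, P q⟫ + ⟪y, p⟫ * ⟪y, q⟫) (x h : Fin n → ℝ) :
    ‖fderiv ℝ F x h‖ ≤ c⁻¹ * ‖P (fderiv ℝ F x h)‖ := by
  set z := fderiv ℝ F x h
  have h1 := hP (ν x) z
  have h2 := hP z z
  have h3 := hP (ν x) (ν x)
  rw [inner_fderiv_eq_zero horth] at h1
  simp only [real_inner_self_eq_norm_sq, hunit] at h2 h3
  have h4 : (⟪y, ν x⟫ * ⟪y, z⟫) ^ 2 ≤ (‖P (ν x)‖ * ‖P z‖) ^ 2 := by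
    rw [show ⟪y, ν x⟫ * ⟪y, z⟫ = -⟪P (ν x), P z⟫ by linarith, neg_sq]
    exact sq_le_sq' (by linarith [neg_le_of_abs_le (abs_real_inner_le_norm (P (ν x)) (P z))])
      (real_inner_le_norm _ _)
  have h5 : ⟪y, ν x⟫ ^ 2 * ‖z‖ ^ 2 ≤ ‖P z‖ ^ 2 := by
    rw [h2]
    nlinarith
  have h6 : c ^ 2 * ‖z‖ ^ 2 ≤ ‖P z‖ ^ 2 :=
    le_trans (by have := hν x; gcongr) h5
  rw [inv_mul_eq_div, le_div_iff₀ hc, mul_comm]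
  exact abs_le_of_sq_le_sq' (by rw [mul_pow]; exact h6) (norm_nonneg _) |>.2

theorem hasFDerivAt_equiv_of_norm_le [FiniteDimensional ℝ H] (hF : ContDiff ℝ (⊤ : ℕ∞) F)
    (himm : ∀ x, (gmet F x).det ≠ 0) (hH : Module.finrank ℝ H = n) {B : ℝ}
    (hFB : ∀ x h, ‖fderiv ℝ F x h‖ ≤ B * ‖P (fderiv ℝ F x h)‖) (x : Fin n → ℝ) :
    ∃ L : (Fin n → ℝ) ≃L[ℝ] H,
      HasFDerivAt (fun x => P (F x)) (L : (Fin n → ℝ) →L[ℝ] H) x := by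
  have hinj : Function.Injective (P ∘L fderiv ℝ F x : (Fin n → ℝ) →L[ℝ] H).toLinearMap := by
    rw [injective_iff_map_eq_zero]
    intro h hh
    have h1 : P (fderiv ℝ F x h) = 0 := hh
    have h2 := hFB x h
    rw [h1, norm_zero, mul_zero, norm_le_zero_iff] at h2
    exact injective_fderiv himm x (h2.trans (map_zero _).symm)
  refine ⟨(LinearEquiv.ofInjectiveOfFinrankEq _ hinj
    (by rw [hH, Module.finrank_fin_fun])).toContinuousLinearEquiv, ?_⟩
  exact P.hasFDerivAt.comp x (hF.differentiable (by simp) x).hasFDerivAt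

theorem range_eq_hyperplane [FiniteDimensional ℝ H] (hn : n ≠ 0) (hF : ContDiff ℝ (⊤ : ℕ∞) F)
    (hν : ContDiff ℝ (⊤ : ℕ∞) ν) (hunit : ∀ x, ‖ν x‖ = 1)
    (horth : ∀ x i, ⟪ν x, pdv i F x⟫ = 0) (himm : ∀ x, (gmet F x).det ≠ 0)
    (hsol : ∀ x, ⟪T, ν x⟫ = -meanCurv F ν x) {c : ℝ} (hc : 0 < c) (hνc : ∀ x, c ≤ ⟪y, ν x⟫)
    (hP : ∀ p q, ⟪p, q⟫ = ⟪P p, P q⟫ + ⟪y, p⟫ * ⟪y, q⟫)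
    (hH : Module.finrank ℝ H = n)
    (hcomplete : ∀ s : ℕ → Fin n → ℝ,
      (∀ ε > 0, ∃ N, ∀ p ≥ N, ∀ q ≥ N, indDist F (s p) (s q) < ε) →
      ∃ x, ∀ ε > 0, ∃ N, ∀ p ≥ N, indDist F (s p) x < ε) :
    ∃ a : EuclideanSpace ℝ (Fin (n + 1)), ∃ d : ℝ,
      ‖a‖ = 1 ∧ Set.range F = {p | ⟪p, a⟫ = d} := by
  have hpos : ∀ x, 0 < ⟪y, ν x⟫ := fun x => hc.trans_le (hνc x)
  have hP1 : ∀ z, ‖P z‖ ≤ ‖z‖ := fun z => by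
    have := hP z z
    simp only [real_inner_self_eq_norm_sq] at this
    exact abs_le_of_sq_le_sq' (by nlinarith [sq_nonneg ⟪y, z⟫]) (norm_nonneg _) |>.2
  have hFB := norm_fderiv_le hc hνc hunit horth hP
  obtain ⟨σ, hσ, hPσ, hσP⟩ := exists_smooth_inverse hF hP1
    (hasFDerivAt_equiv_of_norm_le hF himm hH hFB) hFB hcomplete
  have hsolv := isSolitonGradient_graphGradient hF hν horth hsol hpos hP
    ((stdOrthonormalBasis ℝ H).reindex (finCongr hH)) hσ hPσ
  set v := graphGradient P y (ν ∘ σ)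
  have hvbound : ∀ z, ⟪v z, v z⟫ ≤ (c ^ 2)⁻¹ := fun z => by
    have h1 := inner_graphGradient_self hP (N := ν ∘ σ) (hpos (σ z)) (hunit (σ z))
    have h2 : c ^ 2 ≤ ⟪y, (ν ∘ σ) z⟫ ^ 2 := by have := hνc (σ z); gcongr; exact this
    have h3 : 0 ≤ ⟪v z, v z⟫ := real_inner_self_nonneg
    rw [inv_eq_one_div, le_div_iff₀ (by positivity)]
    change ⟪y, (ν ∘ σ) z⟫ ^ 2 * (1 + ⟪v z, v z⟫) = 1 at h1
    nlinarith [sq_nonneg ⟪y, (ν ∘ σ) z⟫]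
  have : Nonempty (Fin n) := ⟨⟨0, Nat.pos_of_ne_zero hn⟩⟩
  have hvconst : ∀ z, v z = v 0 := fun z =>
    is_const_of_fderiv_eq_zero (hsolv.contDiff.differentiable (by simp))
      (hsolv.fderiv_eq_zero hvbound) z 0
  have hext : ∀ p q, P p = P q → ⟪y, p⟫ = ⟪y, q⟫ → p = q := fun p q h1 h2 => by
    rw [← sub_eq_zero, ← inner_self_eq_zero (𝕜 := ℝ), hP, map_sub, inner_sub_right y, h1, h2]
    simp
  set a := ν (σ 0) with ha
  have hνconst : ∀ x, ν x = a := fun x => by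
    have h0 : ⟪y, ν x⟫ = ⟪y, a⟫ := by
      have h1 := inner_graphGradient_self hP (N := ν ∘ σ) (z := P (F x)) (hpos _) (hunit _)
      have h2 := inner_graphGradient_self hP (N := ν ∘ σ) (z := 0) (hpos _) (hunit _)
      change _ * (1 + ⟪v (P (F x)), v (P (F x))⟫) = 1 at h1
      change _ * (1 + ⟪v 0, v 0⟫) = 1 at h2
      rw [hvconst] at h1
      have h3 : (1 + ⟪v 0, v 0⟫) ≠ 0 := right_ne_zero_of_mul_eq_one h2
      have h4 := mul_right_cancel₀ h3 (h1.trans h2.symm)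
      simp only [Function.comp, hσP] at h4
      exact (pow_left_inj₀ (hpos x).le (hpos _).le two_ne_zero).1 h4
    refine hext _ _ ?_ h0
    have h1 : P ((ν ∘ σ) (P (F x))) = _ := smul_graphGradient (hpos _)
    have h2 : P ((ν ∘ σ) 0) = _ := smul_graphGradient (hpos _)
    change _ = -(_ • v (P (F x))) at h1
    change _ = -(_ • v 0) at h2
    simp only [Function.comp, hσP] at h1 h2
    rw [h1, ha, h2, hvconst, h0]
  have hFa : ∀ x, ⟪F x, a⟫ = ⟪F 0, a⟫ := fun x => by
    have hd : ∀ x, HasFDerivAt (fun x => ⟪a, F x⟫) ((innerSL ℝ a) ∘L fderiv ℝ F x) x := fun x =>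
      (innerSL ℝ a).hasFDerivAt.comp x (hF.differentiable (by simp) x).hasFDerivAt
    rw [real_inner_comm, real_inner_comm a]
    refine is_const_of_fderiv_eq_zero (𝕜 := ℝ) (f := fun x => ⟪a, F x⟫)
      (fun x => (hd x).differentiableAt) (fun x => ?_) x 0
    rw [(hd x).fderiv]
    ext1 h
    simp only [ContinuousLinearMap.comp_apply, innerSL_apply_apply]
    rw [← hνconst x]
    exact inner_fderiv_eq_zero horth x h
  refine ⟨a, ⟪F 0, a⟫, hunit _, Set.Subset.antisymm ?_ fun p hp => ⟨σ (P p), ?_⟩⟩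
  · rintro _ ⟨x, rfl⟩
    exact hFa x
  · refine hext _ _ (hPσ _) ?_
    have h1 := hP (F (σ (P p))) a
    have h2 := hP p a
    rw [hFa, hPσ] at h1
    rw [Set.mem_ofPred_eq] at hp
    rw [hp] at h2
    exact mul_right_cancel₀ (hpos (σ 0)).ne' (by linarith)

end Bernstein

/-- main theorem: a complete translating soliton in ℝⁿ⁺¹ (n ≥ 2) with
bounded mean curvature whose Gauss map image lies in a geodesic ball B_Λ(y₀) ⊂ Sⁿ with
Λ < π/2 is a hyperplane. -/
theorem translating_soliton_bernstein
    {n : ℕ} (hn : 2 ≤ n)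
    (F ν : (Fin n → ℝ) → EuclideanSpace ℝ (Fin (n + 1)))
    (T : EuclideanSpace ℝ (Fin (n + 1))) (hT : T ≠ 0)
    (hF : ContDiff ℝ (⊤ : ℕ∞) F) (hν : ContDiff ℝ (⊤ : ℕ∞) ν)
    (hunit : ∀ x, ‖ν x‖ = 1)
    (horth : ∀ x i, ⟪ν x, pdv i F x⟫ = 0)
    (himm : ∀ x, (gmet F x).det ≠ 0)
    (hsol : ∀ x, ⟪T, ν x⟫ = -meanCurv F ν x)
    (hbd : ∃ C : ℝ, ∀ x, |meanCurv F ν x| ≤ C)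
    (y₀ : EuclideanSpace ℝ (Fin (n + 1))) (hy₀ : ‖y₀‖ = 1)
    (Λ : ℝ) (hΛ : Λ < π / 2)
    (hgauss : ∀ x, Real.arccos ⟪y₀, ν x⟫ < Λ)
    (hcomplete : ∀ s : ℕ → Fin n → ℝ,
      (∀ ε > 0, ∃ N, ∀ p ≥ N, ∀ q ≥ N, indDist F (s p) (s q) < ε) →
      ∃ x, ∀ ε > 0, ∃ N, ∀ p ≥ N, indDist F (s p) x < ε) :
    ∃ a : EuclideanSpace ℝ (Fin (n + 1)), ∃ c : ℝ,
      ‖a‖ = 1 ∧ Set.range F = {p | ⟪p, a⟫ = c} := by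
  have hΛ0 : 0 < Λ := (Real.arccos_nonneg _).trans_lt (hgauss 0)
  have hc : 0 < Real.cos Λ := Real.cos_pos_of_mem_Ioo ⟨by linarith [Real.pi_pos], hΛ⟩
  have hνc : ∀ x, Real.cos Λ ≤ ⟪y₀, ν x⟫ := fun x => by
    have h1 := abs_le.1 (abs_real_inner_le_norm y₀ (ν x))
    rw [hy₀, hunit, one_mul] at h1
    rw [← Real.cos_arccos h1.1 h1.2]
    exact Real.cos_le_cos_of_nonneg_of_le_pi (Real.arccos_nonneg _)
      (by linarith [Real.pi_pos]) (hgauss x).le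
  have : Fact (Module.finrank ℝ (EuclideanSpace ℝ (Fin (n + 1))) = n + 1) := ⟨by simp⟩
  have hy0 : y₀ ≠ 0 := fun h => by simp [h] at hy₀
  refine range_eq_hyperplane (P := (ℝ ∙ y₀)ᗮ.orthogonalProjectionOnto) (by omega) hF hν hunit
    horth himm hsol hc hνc (fun p q => ?_)
    (Submodule.finrank_orthogonal_span_singleton hy0) hcomplete
  conv_lhs => rw [← (ℝ ∙ y₀).starProjection_add_starProjection_orthogonal q, inner_add_right,
    Submodule.starProjection_unit_singleton ℝ hy₀, inner_smul_right, real_inner_comm y₀]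
  rw [Submodule.inner_orthogonalProjectionOnto_eq_of_mem_right, Submodule.starProjection_apply,
    add_comm, mul_comm]

end
end
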